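/- arXiv:1807.09027 — 5 statements merged into one kernel-verified Lean document; each statement's English description precedes it below -/
import Mathlib

section
/- Sharp fractional Hardy inequality: Let d ≥ 1 be an integer and let 0 < α < d. Then for every Schwartz function f : ℝ^d → ℂ one has ∫_{ℝ^d} (2π|ξ|)^α |𝓕f(ξ)|² dξ ≥ 𝓗_{d,α} · ∫_{ℝ^d} |x|^{-α} |f(x)|² dx. -/
open MeasureTheory Real FourierTransform

namespace FractionalHardy

open Set Module
open scoped ENNReal

section HalfLine

theorem lintegral_Ioi_comp_mul_left (g : ℝ → ℝ≥0∞) {c : ℝ} (hc : 0 < c) :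
    ∫⁻ t in Ioi (0 : ℝ), g t = ENNReal.ofReal c * ∫⁻ t in Ioi (0 : ℝ), g (c * t) := by
  have himage : (fun t : ℝ => c * t) '' Ioi 0 = Ioi 0 := by
    rw [image_mul_left_Ioi hc, mul_zero]
  have h := lintegral_image_eq_lintegral_abs_deriv_mul (s := Ioi 0) (f := fun t : ℝ => c * t)
    (f' := fun _ => c) measurableSet_Ioi
    (fun x _ => by simpa using ((hasDerivAt_id x).const_mul c).hasDerivWithinAt)
    (mul_right_injective₀ hc.ne').injOn g
  rw [himage] at h
  rw [h, abs_of_pos hc, lintegral_const_mul' _ _ ENNReal.ofReal_ne_top]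

theorem lintegral_Ioi_comp_inv (g : ℝ → ℝ≥0∞) :
    ∫⁻ t in Ioi (0 : ℝ), g t
      = ∫⁻ t in Ioi (0 : ℝ), ENNReal.ofReal (t ^ (-2 : ℝ)) * g t⁻¹ := by
  have himage : (fun t : ℝ => t⁻¹) '' Ioi 0 = Ioi 0 := by
    ext x
    exact ⟨fun ⟨y, hy, h⟩ => h ▸ inv_pos.2 (mem_Ioi.1 hy),
      fun hx => ⟨x⁻¹, inv_pos.2 (mem_Ioi.1 hx), inv_inv x⟩⟩
  have h := lintegral_image_eq_lintegral_abs_deriv_mul (s := Ioi 0) (f := fun t : ℝ => t⁻¹)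
    (f' := fun t => -(t ^ 2)⁻¹) measurableSet_Ioi
    (fun x hx => (hasDerivAt_inv (ne_of_gt hx)).hasDerivWithinAt) inv_injective.injOn g
  rw [himage] at h
  rw [h]
  refine setLIntegral_congr_fun measurableSet_Ioi fun t ht => ?_
  have ht : 0 < t := ht
  rw [abs_neg, abs_of_pos (by positivity), rpow_neg ht.le, rpow_two]

theorem lintegral_rpow_mul_exp {a r : ℝ} (ha : 0 < a) (hr : 0 < r) :
    ∫⁻ t in Ioi (0 : ℝ), ENNReal.ofReal (t ^ (a - 1) * rexp (-(r * t)))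
      = ENNReal.ofReal ((1 / r) ^ a * Real.Gamma a) := by
  have h := Real.integral_rpow_mul_exp_neg_mul_Ioi ha hr
  have hpos : 0 < (1 / r) ^ a * Real.Gamma a := by
    have := Real.Gamma_pos_of_pos ha
    positivity
  rw [← h, ofReal_integral_eq_lintegral_ofReal]
  · exact Integrable.of_integral_ne_zero (by rw [h]; exact hpos.ne')
  · filter_upwards [self_mem_ae_restrict measurableSet_Ioi] with t ht
    have ht : 0 < t := ht
    positivity

theorem lintegral_rpow_mul_rpow_comp_add_aux (a b : ℝ) {φ : ℝ → ℝ≥0∞} (hφ : Measurable φ) :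
    ∫⁻ t in Ioi (0 : ℝ), ∫⁻ s in Ioi (0 : ℝ),
        ENNReal.ofReal (t ^ (a - 1)) * ENNReal.ofReal (s ^ (b - 1)) * φ (t + s)
      = (∫⁻ r in Ioi (0 : ℝ), ENNReal.ofReal (r ^ (b - 1) * (1 + r) ^ (-(a + b))))
        * ∫⁻ u in Ioi (0 : ℝ), ENNReal.ofReal (u ^ (a + b - 1)) * φ u := by
  calc
    _ = ∫⁻ t in Ioi (0 : ℝ), ∫⁻ r in Ioi (0 : ℝ), ENNReal.ofReal (r ^ (b - 1)) *
          (ENNReal.ofReal (t ^ (a + b - 1)) * φ ((1 + r) * t)) := by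
      refine setLIntegral_congr_fun measurableSet_Ioi fun t ht => ?_
      have ht : 0 < t := ht
      rw [lintegral_Ioi_comp_mul_left _ ht, ← lintegral_const_mul' _ _ ENNReal.ofReal_ne_top]
      refine setLIntegral_congr_fun measurableSet_Ioi fun r hr => ?_
      have hr : 0 < r := hr
      rw [← mul_assoc, ← mul_assoc, ← mul_assoc, ← ENNReal.ofReal_mul (by positivity),
        ← ENNReal.ofReal_mul (by positivity), ← ENNReal.ofReal_mul (by positivity),
        show t + t * r = (1 + r) * t by ring]
      congr 2
      rw [mul_rpow ht.le hr.le, show a + b - 1 = 1 + (a - 1) + (b - 1) by ring,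
        rpow_add ht, rpow_add ht, rpow_one]
      ring
    _ = ∫⁻ r in Ioi (0 : ℝ), ∫⁻ t in Ioi (0 : ℝ), ENNReal.ofReal (r ^ (b - 1)) *
          (ENNReal.ofReal (t ^ (a + b - 1)) * φ ((1 + r) * t)) :=
      lintegral_lintegral_swap (by fun_prop)
    _ = ∫⁻ r in Ioi (0 : ℝ), ENNReal.ofReal (r ^ (b - 1) * (1 + r) ^ (-(a + b))) *
          ∫⁻ u in Ioi (0 : ℝ), ENNReal.ofReal (u ^ (a + b - 1)) * φ u := by
      refine setLIntegral_congr_fun measurableSet_Ioi fun r hr => ?_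
      have hr : 0 < r := hr
      have hr1 : 0 < 1 + r := by linarith
      rw [lintegral_Ioi_comp_mul_left (fun u => ENNReal.ofReal (u ^ (a + b - 1)) * φ u) hr1,
        ← mul_assoc, ← ENNReal.ofReal_mul (by positivity),
        ← lintegral_const_mul' _ _ ENNReal.ofReal_ne_top]
      refine setLIntegral_congr_fun measurableSet_Ioi fun t ht => ?_
      have ht : 0 < t := ht
      rw [← mul_assoc, ← mul_assoc, ← ENNReal.ofReal_mul (by positivity),
        ← ENNReal.ofReal_mul (by positivity)]
      congr 2
      rw [mul_rpow hr1.le ht.le, rpow_neg hr1.le, rpow_sub_one hr1.ne']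
      field_simp
    _ = _ := lintegral_mul_const _ (by fun_prop)

/-- The Dirichlet integral over the simplex: the convolution of two powers is a power. -/
theorem lintegral_rpow_mul_rpow_comp_add {a b : ℝ} (ha : 0 < a) (hb : 0 < b)
    {φ : ℝ → ℝ≥0∞} (hφ : Measurable φ) :
    ∫⁻ t in Ioi (0 : ℝ), ∫⁻ s in Ioi (0 : ℝ),
        ENNReal.ofReal (t ^ (a - 1)) * ENNReal.ofReal (s ^ (b - 1)) * φ (t + s)
      = ENNReal.ofReal (Real.Gamma a * Real.Gamma b / Real.Gamma (a + b))
        * ∫⁻ u in Ioi (0 : ℝ), ENNReal.ofReal (u ^ (a + b - 1)) * φ u := by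
  rw [lintegral_rpow_mul_rpow_comp_add_aux a b hφ]
  congr 1
  have hGa := Real.Gamma_pos_of_pos ha
  have hGb := Real.Gamma_pos_of_pos hb
  have hGab := Real.Gamma_pos_of_pos (add_pos ha hb)
  have hgamma : ∀ {c : ℝ}, 0 < c →
      ∫⁻ t in Ioi (0 : ℝ), ENNReal.ofReal (t ^ (c - 1)) * ENNReal.ofReal (rexp (-t))
        = ENNReal.ofReal (Real.Gamma c) := by
    intro c hc
    have h := lintegral_rpow_mul_exp hc one_pos
    simp only [one_mul, div_one, one_rpow] at h
    rw [← h]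
    refine setLIntegral_congr_fun measurableSet_Ioi fun t ht => ?_
    have ht : 0 < t := ht
    exact (ENNReal.ofReal_mul (by positivity)).symm
  have h := lintegral_rpow_mul_rpow_comp_add_aux a b
    (φ := fun t => ENNReal.ofReal (rexp (-t))) (by fun_prop)
  rw [hgamma (add_pos ha hb)] at h
  have hleft : ∫⁻ t in Ioi (0 : ℝ), ∫⁻ s in Ioi (0 : ℝ),
      ENNReal.ofReal (t ^ (a - 1)) * ENNReal.ofReal (s ^ (b - 1))
        * ENNReal.ofReal (rexp (-(t + s)))
      = ENNReal.ofReal (Real.Gamma a) * ENNReal.ofReal (Real.Gamma b) := by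
    rw [← hgamma ha, ← hgamma hb, ← lintegral_mul_const _ (by fun_prop)]
    refine lintegral_congr fun t => ?_
    rw [← lintegral_const_mul _ (by fun_prop)]
    refine lintegral_congr fun s => ?_
    rw [neg_add, Real.exp_add, ENNReal.ofReal_mul (by positivity)]
    ring
  rw [hleft] at h
  rw [ENNReal.ofReal_div_of_pos hGab, ENNReal.ofReal_mul hGa.le, h,
    ENNReal.mul_div_cancel_right (by simpa using hGab) ENNReal.ofReal_ne_top]

end HalfLine

section HeatKernel

variable {V : Type*} [NormedAddCommGroup V] [InnerProductSpace ℝ V]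

/-- The heat kernel `(4πt)^{-n/2} exp(-‖z‖²/(4t))` of an `n`-dimensional Euclidean space. -/
noncomputable def heatKernel (t : ℝ) (z : V) : ℝ :=
  (4 * π * t) ^ (-(finrank ℝ V : ℝ) / 2) * rexp (-‖z‖ ^ 2 / (4 * t))

theorem heatKernel_nonneg {t : ℝ} (ht : 0 < t) (z : V) : 0 ≤ heatKernel t z := by
  unfold heatKernel; positivity

theorem heatKernel_neg (t : ℝ) (z : V) : heatKernel t (-z) = heatKernel t z := by
  simp [heatKernel]

variable (V) in
/-- The constant `c` with `∫₀^∞ t^{a-1} p_t(z) dt = c ‖z‖^{2a-n}`, where `p_t` is the heat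
kernel. -/
noncomputable def rieszConst (a : ℝ) : ℝ :=
  (4 * π) ^ (-(finrank ℝ V : ℝ) / 2) * 4 ^ ((finrank ℝ V : ℝ) / 2 - a)
    * Real.Gamma ((finrank ℝ V : ℝ) / 2 - a)

theorem rieszConst_pos {a : ℝ} (ha : a < (finrank ℝ V : ℝ) / 2) : 0 < rieszConst V a := by
  have := Real.Gamma_pos_of_pos (sub_pos.2 ha)
  unfold rieszConst
  positivity

theorem schurConst_nonneg {a b : ℝ} (ha : 0 < a) (hb : 0 < b)
    (hab : a + b < (finrank ℝ V : ℝ) / 2) :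
    0 ≤ Real.Gamma a * Real.Gamma b / Real.Gamma (a + b)
      * (rieszConst V (a + b) / rieszConst V b) := by
  have hRb : 0 < rieszConst V b := rieszConst_pos (by linarith)
  have hRab : 0 < rieszConst V (a + b) := rieszConst_pos hab
  have hGa := Real.Gamma_pos_of_pos ha
  have hGb := Real.Gamma_pos_of_pos hb
  have hGab := Real.Gamma_pos_of_pos (add_pos ha hb)
  positivity

/-- The sharp Hardy constant `2^α Γ((n+α)/4)² / Γ((n-α)/4)²`. -/
noncomputable def hardyConst (n α : ℝ) : ℝ :=
  2 ^ α * Real.Gamma ((n + α) / 4) ^ 2 / Real.Gamma ((n - α) / 4) ^ 2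

theorem hardyConst_pos {n α : ℝ} (hα : 0 < α) (hαn : α < n) : 0 < hardyConst n α := by
  have h1 := Real.Gamma_pos_of_pos (show 0 < (n + α) / 4 by linarith)
  have h2 := Real.Gamma_pos_of_pos (show 0 < (n - α) / 4 by linarith)
  unfold hardyConst
  positivity

theorem schurConst_eq {α : ℝ} (hα : 0 < α) (hαn : α < finrank ℝ V) :
    Real.Gamma (α / 2) * Real.Gamma ((finrank ℝ V - α) / 4)
        / Real.Gamma (α / 2 + (finrank ℝ V - α) / 4)
        * (rieszConst V (α / 2 + (finrank ℝ V - α) / 4) / rieszConst V ((finrank ℝ V - α) / 4))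
      = Real.Gamma (α / 2) * (hardyConst (finrank ℝ V) α)⁻¹ := by
  have h1 := Real.Gamma_pos_of_pos (show 0 < (finrank ℝ V + α) / 4 by linarith)
  have h2 := Real.Gamma_pos_of_pos (show 0 < (finrank ℝ V - α) / 4 by linarith)
  have hpow : (4 : ℝ) ^ (((finrank ℝ V : ℝ) + α) / 4)
      = 4 ^ (((finrank ℝ V : ℝ) - α) / 4) * 2 ^ α := by
    rw [show (4 : ℝ) = 2 ^ (2 : ℝ) by norm_num, ← rpow_mul (by norm_num),
      ← rpow_mul (by norm_num), ← rpow_add (by norm_num)]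
    congr 1
    ring
  unfold rieszConst hardyConst
  rw [show α / 2 + ((finrank ℝ V : ℝ) - α) / 4 = (finrank ℝ V + α) / 4 by ring,
    show (finrank ℝ V : ℝ) / 2 - (finrank ℝ V + α) / 4 = (finrank ℝ V - α) / 4 by ring,
    show (finrank ℝ V : ℝ) / 2 - (finrank ℝ V - α) / 4 = (finrank ℝ V + α) / 4 by ring, hpow]
  field_simp

/-- A multiple of the Riesz kernel `‖z‖^{2a-n}`, as a Mellin transform of the heat kernel. -/
noncomputable def potentialKernel (a : ℝ) (z : V) : ℝ≥0∞ :=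
  ∫⁻ t in Ioi (0 : ℝ), ENNReal.ofReal (t ^ (a - 1)) * ENNReal.ofReal (heatKernel t z)

theorem potentialKernel_neg (a : ℝ) (z : V) : potentialKernel a (-z) = potentialKernel a z := by
  simp only [potentialKernel, heatKernel_neg]

theorem potentialKernel_eq {a : ℝ} (ha : a < (finrank ℝ V : ℝ) / 2) {z : V}
    (hz : z ≠ 0) :
    potentialKernel a z = ENNReal.ofReal (rieszConst V a * ‖z‖ ^ (2 * a - finrank ℝ V)) := by
  have hz' : 0 < ‖z‖ := norm_pos_iff.2 hz
  have hr : 0 < ‖z‖ ^ 2 / 4 := by positivity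
  rw [potentialKernel, lintegral_Ioi_comp_inv]
  calc
    _ = ∫⁻ t in Ioi (0 : ℝ), ENNReal.ofReal ((4 * π) ^ (-(finrank ℝ V : ℝ) / 2)) *
          ENNReal.ofReal (t ^ ((finrank ℝ V : ℝ) / 2 - a - 1) * rexp (-(‖z‖ ^ 2 / 4 * t))) := by
      refine setLIntegral_congr_fun measurableSet_Ioi fun t ht => ?_
      have ht : 0 < t := ht
      rw [← ENNReal.ofReal_mul (by positivity), ← ENNReal.ofReal_mul (by positivity),
        ← ENNReal.ofReal_mul (by positivity)]
      congr 1
      unfold heatKernel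
      rw [mul_rpow (x := 4 * π) (by positivity) (by positivity),
        show -‖z‖ ^ 2 / (4 * t⁻¹) = -(‖z‖ ^ 2 / 4 * t) by field_simp,
        inv_rpow ht.le, ← rpow_neg ht.le, inv_rpow ht.le, ← rpow_neg ht.le,
        show (finrank ℝ V : ℝ) / 2 - a - 1 = -2 + (-(a - 1)) + (-(-(finrank ℝ V : ℝ) / 2)) by ring,
        rpow_add ht, rpow_add ht]
      ring
    _ = _ := by
      rw [lintegral_const_mul' _ _ ENNReal.ofReal_ne_top,
        lintegral_rpow_mul_exp (sub_pos.2 ha) hr, ← ENNReal.ofReal_mul (by positivity)]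
      congr 1
      unfold rieszConst
      rw [show 1 / (‖z‖ ^ 2 / 4) = 4 * ‖z‖ ^ (-2 : ℝ) by
          rw [rpow_neg hz'.le, rpow_two]; field_simp,
        mul_rpow (x := 4) (y := ‖z‖ ^ (-2 : ℝ)) (by positivity) (by positivity),
        ← rpow_mul hz'.le,
        show -2 * ((finrank ℝ V : ℝ) / 2 - a) = 2 * a - finrank ℝ V by ring]
      ring

variable [MeasurableSpace V] [BorelSpace V]

@[fun_prop]
theorem measurable_heatKernel {β : Type*} [MeasurableSpace β] {t : β → ℝ} {z : β → V}
    (ht : Measurable t) (hz : Measurable z) : Measurable fun b => heatKernel (t b) (z b) := by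
  unfold heatKernel; fun_prop

@[fun_prop]
theorem measurable_potentialKernel (a : ℝ) : Measurable (potentialKernel (V := V) a) :=
  Measurable.lintegral_prod_right' (f := fun p : V × ℝ =>
    ENNReal.ofReal (p.2 ^ (a - 1)) * ENNReal.ofReal (heatKernel p.2 p.1)) (by fun_prop)

variable [FiniteDimensional ℝ V]

theorem lintegral_heatKernel_mul_heatKernel {t s : ℝ} (ht : 0 < t) (hs : 0 < s) (x : V) :
    ∫⁻ y, ENNReal.ofReal (heatKernel t (x - y)) * ENNReal.ofReal (heatKernel s y)
      = ENNReal.ofReal (heatKernel (t + s) x) := by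
  have hts : 0 < t + s := add_pos ht hs
  set b : ℝ := (t + s) / (4 * t * s) with hb_def
  set c : ℝ := s / (t + s) with hc_def
  have hb : 0 < b := by positivity
  have h_int := GaussianFourier.integral_rexp_neg_mul_sq_norm (V := V) hb
  have hpos : 0 < (π / b) ^ ((finrank ℝ V : ℝ) / 2) := by positivity
  have hlint : ∫⁻ y : V, ENNReal.ofReal (rexp (-b * ‖y - c • x‖ ^ 2))
      = ENNReal.ofReal ((π / b) ^ ((finrank ℝ V : ℝ) / 2)) := by
    rw [lintegral_sub_right_eq_self (fun y : V => ENNReal.ofReal (rexp (-b * ‖y‖ ^ 2))),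
      ← h_int, ofReal_integral_eq_lintegral_ofReal
        (Integrable.of_integral_ne_zero (by rw [h_int]; exact hpos.ne'))
        (Filter.Eventually.of_forall fun _ => (exp_pos _).le)]
  have hpoint : ∀ y : V,
      ENNReal.ofReal (heatKernel t (x - y)) * ENNReal.ofReal (heatKernel s y)
      = ENNReal.ofReal ((4 * π * t) ^ (-(finrank ℝ V : ℝ) / 2)
          * (4 * π * s) ^ (-(finrank ℝ V : ℝ) / 2) * rexp (-‖x‖ ^ 2 / (4 * (t + s))))
        * ENNReal.ofReal (rexp (-b * ‖y - c • x‖ ^ 2)) := by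
    intro y
    rw [← ENNReal.ofReal_mul (heatKernel_nonneg ht _), ← ENNReal.ofReal_mul (by positivity)]
    congr 1
    have hexp : rexp (-‖x - y‖ ^ 2 / (4 * t)) * rexp (-‖y‖ ^ 2 / (4 * s))
        = rexp (-‖x‖ ^ 2 / (4 * (t + s))) * rexp (-b * ‖y - c • x‖ ^ 2) := by
      rw [← Real.exp_add, ← Real.exp_add, norm_sub_sq_real, norm_sub_sq_real, norm_smul,
        inner_smul_right, real_inner_comm, mul_pow, norm_eq_abs, sq_abs, hb_def, hc_def]
      congr 1
      field_simp
      ring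
    unfold heatKernel
    linear_combination ((4 * π * t) ^ (-(finrank ℝ V : ℝ) / 2)
      * (4 * π * s) ^ (-(finrank ℝ V : ℝ) / 2)) * hexp
  simp_rw [hpoint]
  rw [lintegral_const_mul' _ _ ENNReal.ofReal_ne_top, hlint, ← ENNReal.ofReal_mul (by positivity)]
  congr 1
  have hconst : (4 * π * t) ^ (-(finrank ℝ V : ℝ) / 2) * (4 * π * s) ^ (-(finrank ℝ V : ℝ) / 2)
      * (π / b) ^ ((finrank ℝ V : ℝ) / 2) = (4 * π * (t + s)) ^ (-(finrank ℝ V : ℝ) / 2) := by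
    rw [neg_div, ← inv_inv (π / b), inv_rpow (by positivity), ← rpow_neg (by positivity),
      ← mul_rpow (by positivity) (by positivity), ← mul_rpow (by positivity) (by positivity)]
    congr 1
    rw [hb_def]
    field_simp
  unfold heatKernel
  linear_combination rexp (-‖x‖ ^ 2 / (4 * (t + s))) * hconst

/-- The composition rule for Riesz potentials, in terms of the heat kernel. -/
theorem lintegral_potential_mul_norm_rpow {a b : ℝ} (ha : 0 < a) (hb : 0 < b)
    (hab : a + b < (finrank ℝ V : ℝ) / 2) {x : V} (hx : x ≠ 0) :
    ∫⁻ y, potentialKernel a (x - y)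
        * ENNReal.ofReal (‖y‖ ^ (2 * b - finrank ℝ V))
      = ENNReal.ofReal (Real.Gamma a * Real.Gamma b / Real.Gamma (a + b)
          * (rieszConst V (a + b) / rieszConst V b)
          * ‖x‖ ^ (2 * (a + b) - finrank ℝ V)) := by
  have : Nontrivial V := ⟨x, 0, hx⟩
  have hRb : 0 < rieszConst V b := rieszConst_pos (by linarith)
  have hRab : 0 < rieszConst V (a + b) := rieszConst_pos hab
  have hGa := Real.Gamma_pos_of_pos ha
  have hGb := Real.Gamma_pos_of_pos hb
  have hGab := Real.Gamma_pos_of_pos (add_pos ha hb)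
  suffices h : ∫⁻ y, potentialKernel a (x - y)
        * potentialKernel b y
      = ENNReal.ofReal (Real.Gamma a * Real.Gamma b / Real.Gamma (a + b))
        * ENNReal.ofReal (rieszConst V (a + b) * ‖x‖ ^ (2 * (a + b) - finrank ℝ V)) by
    have hae : ∀ᵐ y : V, y ≠ 0 := by simp [ae_iff]
    calc
      _ = ∫⁻ y, ENNReal.ofReal (rieszConst V b)⁻¹ *
          (potentialKernel a (x - y)
          * potentialKernel b y) := by
        refine lintegral_congr_ae ?_
        filter_upwards [hae] with y hy
        rw [potentialKernel_eq (by linarith) hy, mul_left_comm,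
          ← ENNReal.ofReal_mul (by positivity), inv_mul_cancel_left₀ hRb.ne']
      _ = _ := by
        rw [lintegral_const_mul' _ _ ENNReal.ofReal_ne_top, h,
          ← ENNReal.ofReal_mul (by positivity), ← ENNReal.ofReal_mul (by positivity)]
        congr 1
        field_simp
  calc
    _ = ∫⁻ y, ∫⁻ t in Ioi (0 : ℝ), ENNReal.ofReal (t ^ (a - 1))
          * ENNReal.ofReal (heatKernel t (x - y))
        * potentialKernel b y := by
      refine lintegral_congr fun y => ?_
      rw [lintegral_mul_const _ (by fun_prop), potentialKernel]
    _ = ∫⁻ t in Ioi (0 : ℝ), ∫⁻ y, ENNReal.ofReal (t ^ (a - 1))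
          * ENNReal.ofReal (heatKernel t (x - y))
        * potentialKernel b y := by
      refine lintegral_lintegral_swap (Measurable.aemeasurable ?_)
      refine Measurable.mul (by fun_prop) ?_
      fun_prop
    _ = ∫⁻ t in Ioi (0 : ℝ), ∫⁻ s in Ioi (0 : ℝ), ENNReal.ofReal (t ^ (a - 1))
          * ENNReal.ofReal (s ^ (b - 1)) * ENNReal.ofReal (heatKernel (t + s) x) := by
      refine setLIntegral_congr_fun measurableSet_Ioi fun t ht => ?_
      have hswap : ∫⁻ y, ENNReal.ofReal (t ^ (a - 1)) * ENNReal.ofReal (heatKernel t (x - y))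
          * potentialKernel b y
          = ∫⁻ y, ∫⁻ s in Ioi (0 : ℝ), ENNReal.ofReal (t ^ (a - 1))
            * ENNReal.ofReal (heatKernel t (x - y))
            * (ENNReal.ofReal (s ^ (b - 1)) * ENNReal.ofReal (heatKernel s y)) := by
        refine lintegral_congr fun y => ?_
        rw [lintegral_const_mul _ (by fun_prop), potentialKernel]
      rw [hswap, lintegral_lintegral_swap (by fun_prop)]
      refine setLIntegral_congr_fun measurableSet_Ioi fun s hs => ?_
      rw [← lintegral_heatKernel_mul_heatKernel ht hs, ← lintegral_const_mul _ (by fun_prop)]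
      refine lintegral_congr fun y => ?_
      ring
    _ = _ := by
      rw [lintegral_rpow_mul_rpow_comp_add ha hb
        (φ := fun u => ENNReal.ofReal (heatKernel u x)) (by fun_prop),
        ← potentialKernel_eq hab hx, potentialKernel]

theorem mul_le_half_add_half {r s : ℝ} (hr : 0 < r) (hs : 0 < s) (q a b : ℝ) :
    a * b ≤ 2⁻¹ * (a ^ 2 * r ^ (-q)) * s ^ q + 2⁻¹ * (b ^ 2 * s ^ (-q)) * r ^ q := by
  have h1 : 0 < r ^ q := by positivity
  have h2 : 0 < s ^ q := by positivity
  rw [rpow_neg hr.le, rpow_neg hs.le]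
  have key : 2⁻¹ * (a ^ 2 * (r ^ q)⁻¹) * s ^ q + 2⁻¹ * (b ^ 2 * (s ^ q)⁻¹) * r ^ q - a * b
      = (a * s ^ q - b * r ^ q) ^ 2 / (2 * r ^ q * s ^ q) := by
    field_simp
    ring
  have : 0 ≤ (a * s ^ q - b * r ^ q) ^ 2 / (2 * r ^ q * s ^ q) := by positivity
  linarith

theorem lintegral_potential_mul_weight {a b : ℝ} (ha : 0 < a) (hb : 0 < b)
    (hab : a + b < (finrank ℝ V : ℝ) / 2) (u : V → ℝ) :
    ∫⁻ x, ∫⁻ y, potentialKernel a (x - y) * ENNReal.ofReal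
        (2⁻¹ * (u x ^ 2 * ‖x‖ ^ (-(2 * b - finrank ℝ V))) * ‖y‖ ^ (2 * b - finrank ℝ V))
      = ENNReal.ofReal (2⁻¹ * (Real.Gamma a * Real.Gamma b / Real.Gamma (a + b)
          * (rieszConst V (a + b) / rieszConst V b)))
        * ∫⁻ x, ENNReal.ofReal (‖x‖ ^ (2 * a) * u x ^ 2) := by
  have hn : 0 < (finrank ℝ V : ℝ) := by linarith
  have : Nontrivial V := Module.finrank_pos_iff.1 (by exact_mod_cast hn)
  have hae : ∀ᵐ y : V, y ≠ 0 := by simp [ae_iff]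
  have hconst := schurConst_nonneg (V := V) ha hb hab
  rw [← lintegral_const_mul' _ _ ENNReal.ofReal_ne_top]
  refine lintegral_congr_ae ?_
  filter_upwards [hae] with x hx
  have hx' : 0 < ‖x‖ := norm_pos_iff.2 hx
  calc
    _ = ∫⁻ y, ENNReal.ofReal (2⁻¹ * (u x ^ 2 * ‖x‖ ^ (-(2 * b - finrank ℝ V))))
          * (potentialKernel a (x - y) * ENNReal.ofReal (‖y‖ ^ (2 * b - finrank ℝ V))) := by
      refine lintegral_congr fun y => ?_
      rw [ENNReal.ofReal_mul (by positivity)]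
      ring
    _ = _ := by
      rw [lintegral_const_mul' _ _ ENNReal.ofReal_ne_top,
        lintegral_potential_mul_norm_rpow ha hb hab hx,
        ← ENNReal.ofReal_mul (by positivity), ← ENNReal.ofReal_mul (by positivity)]
      congr 1
      rw [show 2 * (a + b) - (finrank ℝ V : ℝ) = 2 * a + (2 * b - finrank ℝ V) by ring,
        rpow_add hx', rpow_neg hx'.le]
      field_simp

/-- A symmetric kernel tested against `F ≤ P + Pᵀ` is controlled by twice its test against `P`. -/
theorem lintegral_symm_kernel_mul_le {X : Type*} [MeasurableSpace X] {μ : Measure X} [SFinite μ]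
    {K F P : X → X → ℝ≥0∞} (hK : Measurable (Function.uncurry K)) (hsymm : ∀ x y, K x y = K y x)
    (hP : Measurable (Function.uncurry P)) (hF : ∀ᵐ x ∂μ, ∀ᵐ y ∂μ, F x y ≤ P x y + P y x) :
    ∫⁻ x, ∫⁻ y, K x y * F x y ∂μ ∂μ ≤ 2 * ∫⁻ x, ∫⁻ y, K x y * P x y ∂μ ∂μ := by
  have hm : Measurable fun p : X × X => K p.1 p.2 * P p.1 p.2 := hK.mul hP
  have hswap : ∫⁻ x, ∫⁻ y, K x y * P y x ∂μ ∂μ = ∫⁻ x, ∫⁻ y, K x y * P x y ∂μ ∂μ := by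
    rw [lintegral_lintegral_swap (hK.mul (hP.comp measurable_swap)).aemeasurable]
    simp_rw [fun x y => hsymm y x]
  calc
    _ ≤ ∫⁻ x, ∫⁻ y, (K x y * P x y + K x y * P y x) ∂μ ∂μ := by
      refine lintegral_mono_ae ?_
      filter_upwards [hF] with x hx
      refine lintegral_mono_ae ?_
      filter_upwards [hx] with y hxy
      rw [← mul_add]
      gcongr
    _ = (∫⁻ x, ∫⁻ y, K x y * P x y ∂μ ∂μ) + ∫⁻ x, ∫⁻ y, K x y * P y x ∂μ ∂μ := by
      rw [← lintegral_add_left hm.lintegral_prod_right']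
      refine lintegral_congr fun x => lintegral_add_left ?_ _
      exact hm.comp measurable_prodMk_left
    _ = _ := by rw [hswap, two_mul]

/-- Schur's test with power weights for the Riesz potential. -/
theorem lintegral_potential_le {a b : ℝ} (ha : 0 < a) (hb : 0 < b)
    (hab : a + b < (finrank ℝ V : ℝ) / 2) {u : V → ℝ} (hu : Measurable u) (hu0 : ∀ x, 0 ≤ u x) :
    ∫⁻ x, ∫⁻ y, potentialKernel a (x - y) * (ENNReal.ofReal (u x) * ENNReal.ofReal (u y))
      ≤ ENNReal.ofReal (Real.Gamma a * Real.Gamma b / Real.Gamma (a + b)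
          * (rieszConst V (a + b) / rieszConst V b))
        * ∫⁻ x, ENNReal.ofReal (‖x‖ ^ (2 * a) * u x ^ 2) := by
  have hn : 0 < (finrank ℝ V : ℝ) := by linarith
  have : Nontrivial V := Module.finrank_pos_iff.1 (by exact_mod_cast hn)
  have hae : ∀ᵐ y : V, y ≠ 0 := by simp [ae_iff]
  have hKm : Measurable (Function.uncurry fun x y : V => potentialKernel a (x - y)) :=
    (measurable_potentialKernel a).comp measurable_sub
  have hPm : Measurable (Function.uncurry fun x y : V => ENNReal.ofReal
      (2⁻¹ * (u x ^ 2 * ‖x‖ ^ (-(2 * b - finrank ℝ V))) * ‖y‖ ^ (2 * b - finrank ℝ V))) := by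
    simp only [Function.uncurry_def]
    fun_prop
  refine (lintegral_symm_kernel_mul_le hKm
    (fun x y => by rw [← potentialKernel_neg, neg_sub]) hPm ?_).trans (le_of_eq ?_)
  · filter_upwards [hae] with x hx
    filter_upwards [hae] with y hy
    rw [← ENNReal.ofReal_mul (hu0 x), ← ENNReal.ofReal_add (by positivity) (by positivity)]
    exact ENNReal.ofReal_le_ofReal
      (mul_le_half_add_half (norm_pos_iff.2 hx) (norm_pos_iff.2 hy) _ _ _)
  · rw [lintegral_potential_mul_weight ha hb hab, ← mul_assoc,
      ENNReal.ofReal_mul (p := 2⁻¹) (by norm_num), ← mul_assoc,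
      ENNReal.ofReal_inv_of_pos two_pos, ENNReal.ofReal_ofNat,
      ENNReal.mul_inv_cancel two_ne_zero ENNReal.ofNat_ne_top, one_mul]

theorem integral_fourier_mul {f g : V → ℂ} (hf : Integrable f) (hg : Integrable g) :
    ∫ ξ, 𝓕 f ξ * g ξ = ∫ x, f x * 𝓕 g x := by
  simpa using! VectorFourier.integral_fourierIntegral_smul_eq_flip (L := innerₗ V)
    Real.continuous_fourierChar continuous_inner hf hg

theorem continuous_fourier_of_integrable {f : V → ℂ} (hf : Integrable f) : Continuous (𝓕 f) :=
  VectorFourier.fourierIntegral_continuous Real.continuous_fourierChar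
    (L := innerₗ V) continuous_inner hf

theorem fourier_gaussian_eq_heatKernel {t : ℝ} (ht : 0 < t) (x w : V) :
    𝓕 (fun v : V => Complex.exp (-((4 * π ^ 2 * t : ℝ) : ℂ) * ‖v‖ ^ 2
        + 2 * π * Complex.I * inner ℝ x v)) w = (heatKernel t (x - w) : ℂ) := by
  have hb : 0 < 4 * π ^ 2 * t := by positivity
  rw [fourier_gaussian_innerProductSpace' (by rwa [Complex.ofReal_re])]
  unfold heatKernel
  rw [Complex.ofReal_mul _ (rexp _), Complex.ofReal_exp]
  congr 1
  · rw [neg_div, rpow_neg (by positivity), ← inv_rpow (by positivity),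
      Complex.ofReal_cpow (by positivity)]
    congr 1
    · push_cast
      field_simp
    · push_cast; rfl
  · congr 1
    push_cast
    field_simp

theorem enorm_fourier_gaussian_mul_fourier_le {t : ℝ} (ht : 0 < t) {h : V → ℂ}
    (hh : Integrable h) (y : V) :
    ‖𝓕 (fun ξ : V => (rexp (-((2 * π * ‖ξ‖) ^ 2 * t)) : ℂ) * 𝓕 h ξ) y‖ₑ
      ≤ ∫⁻ x, ‖h x‖ₑ * ENNReal.ofReal (heatKernel t (y + x)) := by
  have hb : 0 < 4 * π ^ 2 * t := by positivity
  have hG : Integrable (fun v : V => Complex.exp (-((4 * π ^ 2 * t : ℝ) : ℂ) * ‖v‖ ^ 2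
      + 2 * π * Complex.I * inner ℝ (-y) v)) :=
    GaussianFourier.integrable_cexp_neg_mul_sq_norm_add (by rwa [Complex.ofReal_re]) _ _
  have heq : 𝓕 (fun ξ : V => (rexp (-((2 * π * ‖ξ‖) ^ 2 * t)) : ℂ) * 𝓕 h ξ) y
      = ∫ x, h x * (heatKernel t (-y - x) : ℂ) := by
    simp_rw [← fourier_gaussian_eq_heatKernel ht]
    rw [← integral_fourier_mul hh hG, Real.fourier_eq']
    refine integral_congr_ae (Filter.Eventually.of_forall fun ξ => ?_)
    simp only [smul_eq_mul]
    rw [← mul_assoc, Complex.ofReal_exp, ← Complex.exp_add, mul_comm, inner_neg_left,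
      real_inner_comm]
    congr 2
    push_cast
    ring
  rw [heq]
  refine (enorm_integral_le_lintegral_enorm _).trans (le_of_eq (lintegral_congr fun x => ?_))
  rw [enorm_mul, show -y - x = -(y + x) by abel, heatKernel_neg]
  congr 1
  rw [← ofReal_norm, Complex.norm_real, Real.norm_of_nonneg (heatKernel_nonneg ht _)]

theorem lintegral_gaussian_mul_norm_fourier_sq_le {t : ℝ} (ht : 0 < t) {g : V → ℂ}
    (hg : Integrable g) :
    ∫⁻ ξ, ENNReal.ofReal (rexp (-((2 * π * ‖ξ‖) ^ 2 * t)) * ‖𝓕 g ξ‖ ^ 2)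
      ≤ ∫⁻ x, ∫⁻ y, ENNReal.ofReal (heatKernel t (x - y))
        * (ENNReal.ofReal ‖g x‖ * ENNReal.ofReal ‖g y‖) := by
  have hb : 0 < 4 * π ^ 2 * t := by positivity
  set h : V → ℂ := fun x => starRingEnd ℂ (g (-x)) with h_def
  have hh : Integrable h :=
    (LinearIsometryEquiv.integrable_comp_iff Complex.conjLIE).2 hg.comp_neg
  have hconj : ∀ ξ, 𝓕 h ξ = starRingEnd ℂ (𝓕 g ξ) := by
    intro ξ
    rw [Real.fourier_eq', Real.fourier_eq', ← integral_conj,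
      ← integral_neg_eq_self (fun x => starRingEnd ℂ _)]
    refine integral_congr_ae (Filter.Eventually.of_forall fun x => ?_)
    simp [h_def, ← Complex.exp_conj, Complex.conj_ofNat]
  have hexp : Integrable fun ξ : V => rexp (-((2 * π * ‖ξ‖) ^ 2 * t)) := by
    refine Integrable.of_integral_ne_zero ?_
    have hgauss := GaussianFourier.integral_rexp_neg_mul_sq_norm (V := V) hb
    have hpos : 0 < (π / (4 * π ^ 2 * t)) ^ ((finrank ℝ V : ℝ) / 2) := by positivity
    rw [← hgauss] at hpos
    convert hpos.ne' using 5
    ring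
  have hbound : ∀ {k : V → ℂ} (ξ : V), ‖𝓕 k ξ‖ ≤ ∫ x, ‖k x‖ := fun {k} ξ =>
    VectorFourier.norm_fourierIntegral_le_integral_norm _ _ (innerₗ V) k ξ
  have hE : Integrable fun ξ : V => (rexp (-((2 * π * ‖ξ‖) ^ 2 * t)) : ℂ) * 𝓕 h ξ :=
    hexp.ofReal.mul_bdd (continuous_fourier_of_integrable hh).aestronglyMeasurable
      (Filter.Eventually.of_forall hbound)
  have heq : ∫ ξ, 𝓕 g ξ * ((rexp (-((2 * π * ‖ξ‖) ^ 2 * t)) : ℂ) * 𝓕 h ξ)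
      = ((∫ ξ, rexp (-((2 * π * ‖ξ‖) ^ 2 * t)) * ‖𝓕 g ξ‖ ^ 2 : ℝ) : ℂ) := by
    rw [← integral_complex_ofReal]
    refine integral_congr_ae (Filter.Eventually.of_forall fun ξ => ?_)
    simp only [hconj]
    rw [mul_left_comm, Complex.mul_conj, Complex.normSq_eq_norm_sq]
    push_cast
    rfl
  have h_int : Integrable fun ξ : V => rexp (-((2 * π * ‖ξ‖) ^ 2 * t)) * ‖𝓕 g ξ‖ ^ 2 := by
    refine hexp.mul_bdd (c := (∫ x, ‖g x‖) ^ 2)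
      ((continuous_fourier_of_integrable hg).norm.pow 2).aestronglyMeasurable
      (Filter.Eventually.of_forall fun ξ => ?_)
    rw [Real.norm_of_nonneg (by positivity)]
    gcongr
    exact hbound ξ
  calc
    _ = ‖∫ ξ, 𝓕 g ξ * ((rexp (-((2 * π * ‖ξ‖) ^ 2 * t)) : ℂ) * 𝓕 h ξ)‖ₑ := by
      rw [heq, ← ofReal_integral_eq_lintegral_ofReal h_int
        (Filter.Eventually.of_forall fun ξ => by positivity), ← ofReal_norm, Complex.norm_real,
        Real.norm_of_nonneg (integral_nonneg fun ξ => by positivity)]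
    _ ≤ ∫⁻ x, ∫⁻ y, ‖g x‖ₑ * (‖h y‖ₑ * ENNReal.ofReal (heatKernel t (x + y))) := by
      rw [integral_fourier_mul hg hE]
      refine (enorm_integral_le_lintegral_enorm _).trans (lintegral_mono fun x => ?_)
      rw [enorm_mul, lintegral_const_mul' _ _ enorm_ne_top]
      gcongr
      exact enorm_fourier_gaussian_mul_fourier_le ht hh x
    _ = _ := by
      refine lintegral_congr fun x => ?_
      rw [← lintegral_neg_eq_self]
      refine lintegral_congr fun y => ?_
      simp only [h_def, neg_neg, ← sub_eq_add_neg, ofReal_norm, RCLike.enorm_conj]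
      ring

/-- The dual form of the Hardy inequality, bounding the Fourier side by the physical side. -/
theorem lintegral_norm_rpow_neg_mul_fourier_le {α : ℝ} (hα : 0 < α) (hαn : α < finrank ℝ V)
    {g : V → ℂ} (hg : Integrable g) (hgm : Measurable g) :
    ∫⁻ ξ, ENNReal.ofReal ((2 * π * ‖ξ‖) ^ (-α) * ‖𝓕 g ξ‖ ^ 2)
      ≤ ENNReal.ofReal (hardyConst (finrank ℝ V) α)⁻¹
        * ∫⁻ x, ENNReal.ofReal (‖x‖ ^ α * ‖g x‖ ^ 2) := by
  have hn : 0 < (finrank ℝ V : ℝ) := by linarith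
  have : Nontrivial V := Module.finrank_pos_iff.1 (by exact_mod_cast hn)
  have hae : ∀ᵐ y : V, y ≠ 0 := by simp [ae_iff]
  have hG : 0 < Real.Gamma (α / 2) := Real.Gamma_pos_of_pos (by linarith)
  have hFm : Measurable (𝓕 g) := (continuous_fourier_of_integrable hg).measurable
  refine (ENNReal.mul_le_mul_iff_right (a := ENNReal.ofReal (Real.Gamma (α / 2)))
    (by simpa using hG) ENNReal.ofReal_ne_top).1 ?_
  calc
    _ = ∫⁻ ξ, ∫⁻ t in Ioi (0 : ℝ), ENNReal.ofReal (t ^ (α / 2 - 1))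
          * ENNReal.ofReal (rexp (-((2 * π * ‖ξ‖) ^ 2 * t)) * ‖𝓕 g ξ‖ ^ 2) := by
      rw [← lintegral_const_mul' _ _ ENNReal.ofReal_ne_top]
      refine lintegral_congr_ae ?_
      filter_upwards [hae] with ξ hξ
      have hξ' : 0 < ‖ξ‖ := norm_pos_iff.2 hξ
      have hr : 0 < (2 * π * ‖ξ‖) ^ 2 := by positivity
      have hpow : ((2 * π * ‖ξ‖) ^ 2) ^ (α / 2) = (2 * π * ‖ξ‖) ^ α := by
        rw [← rpow_natCast, ← rpow_mul (by positivity)]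
        congr 1
        push_cast
        ring
      calc
        _ = ENNReal.ofReal (‖𝓕 g ξ‖ ^ 2) * ∫⁻ t in Ioi (0 : ℝ),
              ENNReal.ofReal (t ^ (α / 2 - 1) * rexp (-((2 * π * ‖ξ‖) ^ 2 * t))) := by
          rw [lintegral_rpow_mul_exp (by linarith) hr, ← ENNReal.ofReal_mul hG.le,
            ← ENNReal.ofReal_mul (by positivity), one_div, inv_rpow hr.le, hpow,
            rpow_neg (by positivity)]
          congr 1
          ring
        _ = _ := by
          rw [← lintegral_const_mul' _ _ ENNReal.ofReal_ne_top]
          refine setLIntegral_congr_fun measurableSet_Ioi fun t ht => ?_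
          have ht : 0 < t := ht
          rw [← ENNReal.ofReal_mul (by positivity), ← ENNReal.ofReal_mul (by positivity)]
          congr 1
          ring
    _ = ∫⁻ t in Ioi (0 : ℝ), ENNReal.ofReal (t ^ (α / 2 - 1))
          * ∫⁻ ξ, ENNReal.ofReal (rexp (-((2 * π * ‖ξ‖) ^ 2 * t)) * ‖𝓕 g ξ‖ ^ 2) := by
      rw [lintegral_lintegral_swap (by fun_prop)]
      refine lintegral_congr fun t => ?_
      rw [lintegral_const_mul' _ _ ENNReal.ofReal_ne_top]
    _ ≤ ∫⁻ t in Ioi (0 : ℝ), ENNReal.ofReal (t ^ (α / 2 - 1))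
          * ∫⁻ x, ∫⁻ y, ENNReal.ofReal (heatKernel t (x - y))
            * (ENNReal.ofReal ‖g x‖ * ENNReal.ofReal ‖g y‖) := by
      refine setLIntegral_mono' measurableSet_Ioi fun t ht => ?_
      exact mul_le_mul' le_rfl (lintegral_gaussian_mul_norm_fourier_sq_le ht hg)
    _ = ∫⁻ x, ∫⁻ y, potentialKernel (α / 2) (x - y)
            * (ENNReal.ofReal ‖g x‖ * ENNReal.ofReal ‖g y‖) := by
      have hF : Measurable fun p : (V × ℝ) × V => ENNReal.ofReal (p.1.2 ^ (α / 2 - 1))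
          * ENNReal.ofReal (heatKernel p.1.2 (p.1.1 - p.2))
          * (ENNReal.ofReal ‖g p.1.1‖ * ENNReal.ofReal ‖g p.2‖) := by fun_prop
      calc
        _ = ∫⁻ t in Ioi (0 : ℝ), ∫⁻ x, ∫⁻ y, ENNReal.ofReal (t ^ (α / 2 - 1))
              * ENNReal.ofReal (heatKernel t (x - y))
              * (ENNReal.ofReal ‖g x‖ * ENNReal.ofReal ‖g y‖) := by
          refine lintegral_congr fun t => ?_
          rw [← lintegral_const_mul' _ _ ENNReal.ofReal_ne_top]
          refine lintegral_congr fun x => ?_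
          rw [← lintegral_const_mul' _ _ ENNReal.ofReal_ne_top]
          simp_rw [mul_assoc]
        _ = ∫⁻ x, ∫⁻ t in Ioi (0 : ℝ), ∫⁻ y, ENNReal.ofReal (t ^ (α / 2 - 1))
              * ENNReal.ofReal (heatKernel t (x - y))
              * (ENNReal.ofReal ‖g x‖ * ENNReal.ofReal ‖g y‖) :=
          (lintegral_lintegral_swap hF.lintegral_prod_right'.aemeasurable).symm
        _ = _ := by
          refine lintegral_congr fun x => ?_
          rw [lintegral_lintegral_swap (by fun_prop)]
          refine lintegral_congr fun y => ?_
          rw [lintegral_mul_const _ (by fun_prop), potentialKernel]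
    _ ≤ _ := by
      refine (lintegral_potential_le (b := (finrank ℝ V - α) / 4) (by linarith) (by linarith)
        (by linarith) hgm.norm fun x => norm_nonneg _).trans (le_of_eq ?_)
      rw [schurConst_eq hα hαn, ENNReal.ofReal_mul hG.le, mul_assoc,
        show 2 * (α / 2) = α by ring]

theorem integrable_norm_rpow_neg_mul_schwartz {α : ℝ} (hα : 0 < α) (hαn : α < finrank ℝ V)
    (f : SchwartzMap V ℂ) : Integrable fun x => ‖x‖ ^ (-α) * ‖f x‖ := by
  have hn : 0 < (finrank ℝ V : ℝ) := by linarith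
  have hn' : 0 < finrank ℝ V := by exact_mod_cast hn
  have : Nontrivial V := Module.finrank_pos_iff.1 hn'
  obtain ⟨C, hC⟩ := f.decay 0 0
  have hC' : ∀ x, ‖f x‖ ≤ C := fun x => by simpa using hC.2 x
  have hloc : Integrable (fun x : V => (Iic (1 : ℝ)).indicator (fun y => y ^ (-α)) ‖x‖) := by
    rw [integrable_fun_norm_addHaar volume (f := (Iic (1 : ℝ)).indicator (fun y => y ^ (-α)))]
    have h := intervalIntegral.intervalIntegrable_rpow' (a := 0) (b := 1)
      (show -1 < (finrank ℝ V : ℝ) - 1 - α by linarith)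
    rw [intervalIntegrable_iff_integrableOn_Ioc_of_le zero_le_one] at h
    have h' := (integrable_indicator_iff measurableSet_Ioc).2 h
    refine h'.integrableOn.congr_fun (fun y hy => ?_) measurableSet_Ioi
    have hy : 0 < y := hy
    by_cases hy1 : y ≤ 1
    · rw [indicator_of_mem (show y ∈ Ioc 0 1 from ⟨hy, hy1⟩), smul_eq_mul,
        indicator_of_mem (show y ∈ Iic 1 from hy1), sub_eq_add_neg _ α, rpow_add hy,
        ← Nat.cast_pred hn', rpow_natCast]
    · rw [indicator_of_notMem (fun h => hy1 h.2), smul_eq_mul,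
        indicator_of_notMem (show y ∉ Iic 1 from hy1), mul_zero]
  refine ((hloc.const_mul C).add f.integrable.norm).mono'
    (by have := f.continuous.measurable; exact Measurable.aestronglyMeasurable (by fun_prop))
    (Filter.Eventually.of_forall fun x => ?_)
  rw [Real.norm_of_nonneg (by positivity)]
  simp only [Pi.add_apply]
  have hC0 : 0 ≤ C := (norm_nonneg _).trans (hC' 0)
  by_cases hx : ‖x‖ ≤ 1
  · rw [indicator_of_mem (show ‖x‖ ∈ Iic 1 from hx)]
    have h1 : 0 ≤ ‖x‖ ^ (-α) := by positivity
    nlinarith [mul_le_mul_of_nonneg_left (hC' x) h1, norm_nonneg (f x)]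
  · rw [indicator_of_notMem (show ‖x‖ ∉ Iic (1 : ℝ) from hx), mul_zero, zero_add]
    have h1 : ‖x‖ ^ (-α) ≤ 1 := rpow_le_one_of_one_le_of_nonpos (not_le.1 hx).le (by linarith)
    nlinarith [norm_nonneg (f x)]

theorem integrable_norm_rpow_neg_mul_schwartz_sq {α : ℝ} (hα : 0 < α) (hαn : α < finrank ℝ V)
    (f : SchwartzMap V ℂ) : Integrable fun x => ‖x‖ ^ (-α) * ‖f x‖ ^ 2 := by
  obtain ⟨C, hC⟩ := f.decay 0 0
  have hC' : ∀ x, ‖f x‖ ≤ C := fun x => by simpa using hC.2 x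
  refine ((integrable_norm_rpow_neg_mul_schwartz hα hαn f).mul_bdd (c := C)
    f.continuous.norm.aestronglyMeasurable
    (Filter.Eventually.of_forall fun x => by simpa using hC' x)).congr
    (Filter.Eventually.of_forall fun x => ?_)
  simp only
  ring

theorem integrable_rpow_norm_mul_schwartz_sq {α : ℝ} (hα : 0 < α) (f : SchwartzMap V ℂ) :
    Integrable fun x => (2 * π * ‖x‖) ^ α * ‖f x‖ ^ 2 := by
  obtain ⟨C, hC⟩ := f.decay 0 0
  have hC' : ∀ x, ‖f x‖ ≤ C := fun x => by simpa using hC.2 x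
  have hC0 : 0 ≤ C := (norm_nonneg _).trans (hC' 0)
  obtain ⟨m, hm⟩ := exists_nat_ge α
  refine (((f.integrable.norm.add (f.integrable_pow_mul volume m)).const_mul
    ((2 * π) ^ α * C))).mono'
    (by have := f.continuous.measurable; exact Measurable.aestronglyMeasurable (by fun_prop))
    (Filter.Eventually.of_forall fun x => ?_)
  rw [Real.norm_of_nonneg (by positivity)]
  simp only [Pi.add_apply]
  have hpow : ‖x‖ ^ α ≤ 1 + ‖x‖ ^ m := by
    rcases le_total ‖x‖ 1 with hx | hx
    · have := rpow_le_one (norm_nonneg x) hx hα.le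
      have : 0 ≤ ‖x‖ ^ m := by positivity
      linarith
    · have := rpow_le_rpow_of_exponent_le hx hm
      rw [rpow_natCast] at this
      linarith
  calc
    _ = (2 * π) ^ α * (‖x‖ ^ α * (‖f x‖ * ‖f x‖)) := by
      rw [mul_rpow (by positivity) (by positivity)]; ring
    _ ≤ (2 * π) ^ α * ((1 + ‖x‖ ^ m) * (C * ‖f x‖)) := by
      gcongr
      exact hC' x
    _ = _ := by ring

theorem fourier_conj_fourier_schwartz (f : SchwartzMap V ℂ) (x : V) :
    𝓕 (fun ξ => starRingEnd ℂ (𝓕 (⇑f) ξ)) x = starRingEnd ℂ (f x) := by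
  have hinv : 𝓕⁻ (𝓕 (⇑f)) x = f x := by
    rw [← SchwartzMap.fourier_coe, ← SchwartzMap.fourierInv_coe]
    simp
  rw [← hinv, Real.fourierInv_eq', Real.fourier_eq', ← integral_conj]
  refine integral_congr_ae (Filter.Eventually.of_forall fun ξ => ?_)
  simp [← Complex.exp_conj, Complex.conj_ofNat]

theorem hardy_schwartz {α : ℝ} (hα : 0 < α) (hαn : α < finrank ℝ V) (f : SchwartzMap V ℂ) :
    hardyConst (finrank ℝ V) α * ∫ x, ‖x‖ ^ (-α) * ‖f x‖ ^ 2
      ≤ ∫ ξ, (2 * π * ‖ξ‖) ^ α * ‖𝓕 (⇑f) ξ‖ ^ 2 := by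
  have hn : 0 < (finrank ℝ V : ℝ) := by linarith
  have : Nontrivial V := Module.finrank_pos_iff.1 (by exact_mod_cast hn)
  have hae : ∀ᵐ y : V, y ≠ 0 := by simp [ae_iff]
  have hH := hardyConst_pos hα hαn
  set H := hardyConst (finrank ℝ V) α
  have hfm : Measurable f := f.continuous.measurable
  have hA := integrable_norm_rpow_neg_mul_schwartz_sq hα hαn f
  have hB : Integrable fun ξ => (2 * π * ‖ξ‖) ^ α * ‖𝓕 (⇑f) ξ‖ ^ 2 := by
    simpa only [SchwartzMap.fourier_coe] using integrable_rpow_norm_mul_schwartz_sq hα (𝓕 f)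
  have hFint : Integrable (𝓕 (⇑f)) := by
    simpa only [SchwartzMap.fourier_coe] using (𝓕 f).integrable
  set A := ∫ x, ‖x‖ ^ (-α) * ‖f x‖ ^ 2 with hA_def
  set B := ∫ ξ, (2 * π * ‖ξ‖) ^ α * ‖𝓕 (⇑f) ξ‖ ^ 2 with hB_def
  have hA0 : 0 ≤ A := integral_nonneg fun x => by positivity
  have hB0 : 0 ≤ B := integral_nonneg fun x => by positivity
  set g : V → ℂ := fun x => ((‖x‖ ^ (-α) : ℝ) : ℂ) * f x with g_def
  have hgm : Measurable g := by fun_prop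
  have hg : Integrable g := by
    refine (integrable_norm_rpow_neg_mul_schwartz hα hαn f).mono' hgm.aestronglyMeasurable
      (Filter.Eventually.of_forall fun x => ?_)
    rw [g_def, norm_mul, Complex.norm_real, Real.norm_of_nonneg (by positivity)]
  have hFm : Measurable (𝓕 g) := (continuous_fourier_of_integrable hg).measurable
  have hdual : ∫⁻ ξ, ENNReal.ofReal ((2 * π * ‖ξ‖) ^ (-α) * ‖𝓕 g ξ‖ ^ 2)
      ≤ ENNReal.ofReal (H⁻¹ * A) := by
    refine (lintegral_norm_rpow_neg_mul_fourier_le hα hαn hg hgm).trans (le_of_eq ?_)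
    rw [ENNReal.ofReal_mul (by positivity), hA_def, ofReal_integral_eq_lintegral_ofReal hA
      (Filter.Eventually.of_forall fun x => by positivity)]
    congr 1
    refine lintegral_congr_ae ?_
    filter_upwards [hae] with x hx
    have hx' : 0 < ‖x‖ := norm_pos_iff.2 hx
    rw [g_def, norm_mul, Complex.norm_real, Real.norm_of_nonneg (by positivity),
      rpow_neg hx'.le]
    congr 1
    field_simp
  have hpair : (A : ℂ) = ∫ ξ, 𝓕 g ξ * starRingEnd ℂ (𝓕 (⇑f) ξ) := by
    have hconj : Integrable fun ξ => starRingEnd ℂ (𝓕 (⇑f) ξ) :=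
      (LinearIsometryEquiv.integrable_comp_iff Complex.conjLIE).2 hFint
    rw [integral_fourier_mul hg hconj, hA_def, ← integral_complex_ofReal]
    refine integral_congr_ae (Filter.Eventually.of_forall fun x => ?_)
    simp only [fourier_conj_fourier_schwartz, g_def]
    rw [mul_assoc, Complex.mul_conj, Complex.normSq_eq_norm_sq, ← Complex.ofReal_mul]
  have hle : ENNReal.ofReal A ≤ ENNReal.ofReal (2⁻¹ * H * (H⁻¹ * A) + 2⁻¹ * H⁻¹ * B) := by
    calc
      ENNReal.ofReal A = ‖∫ ξ, 𝓕 g ξ * starRingEnd ℂ (𝓕 (⇑f) ξ)‖ₑ := by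
        rw [← hpair, ← ofReal_norm, Complex.norm_real, Real.norm_of_nonneg hA0]
      _ ≤ ∫⁻ ξ, ‖𝓕 g ξ * starRingEnd ℂ (𝓕 (⇑f) ξ)‖ₑ := enorm_integral_le_lintegral_enorm _
      _ ≤ ∫⁻ ξ, (ENNReal.ofReal (2⁻¹ * H)
              * ENNReal.ofReal ((2 * π * ‖ξ‖) ^ (-α) * ‖𝓕 g ξ‖ ^ 2)
            + ENNReal.ofReal (2⁻¹ * H⁻¹)
              * ENNReal.ofReal ((2 * π * ‖ξ‖) ^ α * ‖𝓕 (⇑f) ξ‖ ^ 2)) := by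
        refine lintegral_mono_ae ?_
        filter_upwards [hae] with ξ hξ
        have hξ' : 0 < ‖ξ‖ := norm_pos_iff.2 hξ
        have hw : 0 < (2 * π * ‖ξ‖) ^ α := by positivity
        rw [← ENNReal.ofReal_mul (by positivity), ← ENNReal.ofReal_mul (by positivity),
          ← ENNReal.ofReal_add (by positivity) (by positivity), ← ofReal_norm, norm_mul,
          RCLike.norm_conj, rpow_neg (by positivity)]
        refine ENNReal.ofReal_le_ofReal ?_
        have key := mul_le_half_add_half hH hw 1 ‖𝓕 (⇑f) ξ‖ ‖𝓕 g ξ‖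
        rw [rpow_neg_one, rpow_neg_one, rpow_one, rpow_one] at key
        linarith
      _ = ENNReal.ofReal (2⁻¹ * H)
              * (∫⁻ ξ, ENNReal.ofReal ((2 * π * ‖ξ‖) ^ (-α) * ‖𝓕 g ξ‖ ^ 2))
            + ENNReal.ofReal (2⁻¹ * H⁻¹)
              * ∫⁻ ξ, ENNReal.ofReal ((2 * π * ‖ξ‖) ^ α * ‖𝓕 (⇑f) ξ‖ ^ 2) := by
        rw [lintegral_add_left (by fun_prop), lintegral_const_mul' _ _ ENNReal.ofReal_ne_top,
          lintegral_const_mul' _ _ ENNReal.ofReal_ne_top]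
      _ ≤ ENNReal.ofReal (2⁻¹ * H) * ENNReal.ofReal (H⁻¹ * A)
            + ENNReal.ofReal (2⁻¹ * H⁻¹) * ENNReal.ofReal B := by
        rw [hB_def, ofReal_integral_eq_lintegral_ofReal hB
          (Filter.Eventually.of_forall fun x => by positivity)]
        gcongr
      _ = _ := by
        rw [← ENNReal.ofReal_mul (by positivity), ← ENNReal.ofReal_mul (by positivity),
          ← ENNReal.ofReal_add (by positivity) (by positivity)]
  rw [ENNReal.ofReal_le_ofReal_iff (by positivity), mul_assoc, mul_inv_cancel_left₀ hH.ne'] at hle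
  have hAB : A ≤ H⁻¹ * B := by linarith
  calc
    H * A ≤ H * (H⁻¹ * B) := by gcongr
    _ = B := mul_inv_cancel_left₀ hH.ne' B

end HeatKernel

end FractionalHardy

/-- Sharp fractional Hardy inequality: for `0 < α < d` and a Schwartz function `f`,
`∫ (2π|ξ|)^α |𝓕f(ξ)|² dξ ≥ 𝓗_{d,α} ∫ |x|^{-α} |f(x)|² dx` with
`𝓗_{d,α} = 2^α Γ((d+α)/4)² / Γ((d-α)/4)²`. -/
theorem sharp_fractional_hardy (d : ℕ) (hd : 1 ≤ d) (α : ℝ) (hα : 0 < α) (hαd : α < d)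
    (f : SchwartzMap (EuclideanSpace ℝ (Fin d)) ℂ) :
    (∫ ξ : EuclideanSpace ℝ (Fin d), (2 * π * ‖ξ‖) ^ α * ‖𝓕 (⇑f) ξ‖ ^ 2) ≥
      (2 ^ α * Real.Gamma (((d : ℝ) + α) / 4) ^ 2 / Real.Gamma (((d : ℝ) - α) / 4) ^ 2) *
        ∫ x : EuclideanSpace ℝ (Fin d), ‖x‖ ^ (-α) * ‖f x‖ ^ 2 := by
  have h := FractionalHardy.hardy_schwartz (V := EuclideanSpace ℝ (Fin d)) hα (by simpa using hαd) f
  rw [finrank_euclideanSpace_fin] at h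
  exact h
end

section
/- Let α and d be real numbers with 0 < α and 2α < d. Then Γ((d+α)/4)² · Γ((d−2α)/4) > Γ((d−α)/4)² · Γ((d+2α)/4). Equivalently, with a_* = −2^α Γ((d+α)/4)²/Γ((d−α)/4)² and a_{**} = −(2^{2α} Γ((d+2α)/4)²/Γ((d−2α)/4)²)^{1/2}, one has a_{**} > a_*. -/
open Real

/-- The cubic inequality `(y + a)² (y - 2a) < (y - a)² (y + 2a)` in logarithmic form. -/
lemma log_cubic_pos {a y : ℝ} (ha : 0 < a) (hy : 2 * a < y) :
    0 < 2 * log (y - a) + log (y + 2 * a) - 2 * log (y + a) - log (y - 2 * a) := by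
  have h1 : 0 < y - a := by linarith
  have h2 : 0 < y + 2 * a := by linarith
  have h3 : 0 < y + a := by linarith
  have h4 : 0 < y - 2 * a := by linarith
  have hlt : (y + a) ^ 2 * (y - 2 * a) < (y - a) ^ 2 * (y + 2 * a) := by
    nlinarith [pow_pos ha 3]
  have hlog := log_lt_log (by positivity) hlt
  rw [log_mul (by positivity) h4.ne', log_mul (by positivity) h2.ne', log_pow, log_pow] at hlog
  push_cast at hlog
  linarith

lemma log_Gamma_combination_pos {a s : ℝ} (ha : 0 < a) (hs : 2 * a < s) :
    0 < 2 * log (Gamma (s + a)) + log (Gamma (s - 2 * a)) -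
      2 * log (Gamma (s - a)) - log (Gamma (s + 2 * a)) := by
  have hlim := ((((BohrMollerup.tendsto_log_gamma (x := s + a) (by linarith)).const_mul 2).add
    (BohrMollerup.tendsto_log_gamma (x := s - 2 * a) (by linarith))).sub
    ((BohrMollerup.tendsto_log_gamma (x := s - a) (by linarith)).const_mul 2)).sub
    (BohrMollerup.tendsto_log_gamma (x := s + 2 * a) (by linarith))
  refine (log_cubic_pos ha hs).trans_le (ge_of_tendsto' hlim fun n => ?_)
  let t : ℕ → ℝ := fun m => 2 * log (s + m - a) + log (s + m + 2 * a) -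
    2 * log (s + m + a) - log (s + m - 2 * a)
  have hsum : t 0 ≤ ∑ m ∈ Finset.range (n + 1), t m :=
    Finset.single_le_sum (f := t)
      (fun m _ => (log_cubic_pos ha (hs.trans_le (by simp))).le) (by simp)
  simp only [t, Finset.sum_sub_distrib, Finset.sum_add_distrib, ← Finset.mul_sum,
    Nat.cast_zero, add_zero] at hsum
  simp only [BohrMollerup.logGammaSeq, add_right_comm s _ (Nat.cast _), sub_add_eq_add_sub]
  linarith

/-- For `0 < α` and `2α < d` one has
`Γ((d+α)/4)² Γ((d-2α)/4) > Γ((d-α)/4)² Γ((d+2α)/4)`, i.e. `a_{**} > a_*`. -/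
theorem gamma_ineq (α d : ℝ) (hα : 0 < α) (hαd : 2 * α < d) :
    Real.Gamma ((d + α) / 4) ^ 2 * Real.Gamma ((d - 2 * α) / 4) >
      Real.Gamma ((d - α) / 4) ^ 2 * Real.Gamma ((d + 2 * α) / 4) := by
  have h := log_Gamma_combination_pos (a := α / 4) (s := d / 4) (by linarith) (by linarith)
  rw [← mul_div_assoc, ← add_div, ← sub_div, ← sub_div, ← add_div] at h
  have h1 : 0 < Gamma ((d + α) / 4) := Gamma_pos_of_pos (by linarith)
  have h2 : 0 < Gamma ((d - 2 * α) / 4) := Gamma_pos_of_pos (by linarith)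
  have h3 : 0 < Gamma ((d - α) / 4) := Gamma_pos_of_pos (by linarith)
  have h4 : 0 < Gamma ((d + 2 * α) / 4) := Gamma_pos_of_pos (by linarith)
  refine (log_lt_log_iff (by positivity) (by positivity)).1 ?_
  rw [log_mul (by positivity) h4.ne', log_mul (by positivity) h2.ne', log_pow, log_pow]
  push_cast
  linarith
end

section
/- Let d ≥ 1 be an integer, let 0 < α < d/2 and let a ∈ ℝ. For every Schwartz function f : ℝ^d → ℂ, let |p|^α f denote the inverse Fourier transform of the function ξ ↦ (2π|ξ|)^α 𝓕f(ξ). Then ‖ |p|^α f + a |x|^{-α} f ‖_{L²(ℝ^d)} ≤ (1 + |a| · 𝓗_{d,2α}^{-1/2}) · ‖ |p|^α f ‖_{L²(ℝ^d)}. -/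
open MeasureTheory Real FourierTransform

open Set in
theorem lintegral_rpow_mul_exp_neg_mul_Ioi {s r : ℝ} (hs : 0 < s) (hr : 0 < r) :
    ∫⁻ t in Ioi (0 : ℝ), ENNReal.ofReal (t ^ (s - 1) * exp (-(r * t))) =
      ENNReal.ofReal (r ^ (-s) * Gamma s) := by
  have h := integral_rpow_mul_exp_neg_mul_Ioi hs hr
  have hr' : (1 / r) ^ s = r ^ (-s) := by rw [one_div, inv_rpow hr.le, rpow_neg hr.le]
  have hpos : 0 < r ^ (-s) * Gamma s := mul_pos (rpow_pos_of_pos hr _) (Gamma_pos_of_pos hs)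
  rw [hr'] at h
  rw [← h, ofReal_integral_eq_lintegral_ofReal]
  · exact .of_integral_ne_zero (by rw [h]; exact hpos.ne')
  · filter_upwards [ae_restrict_mem measurableSet_Ioi] with t ht
    have : (0 : ℝ) < t := ht
    positivity

open Set in
theorem lintegral_rpow_mul_exp_neg_div_Ioi {s r : ℝ} (hs : 0 < s) (hr : 0 < r) :
    ∫⁻ t in Ioi (0 : ℝ), ENNReal.ofReal (t ^ (-s - 1) * exp (-(r / t))) =
      ENNReal.ofReal (r ^ (-s) * Gamma s) := by
  have h := integral_rpow_mul_exp_neg_mul_Ioi hs hr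
  have hr' : (1 / r) ^ s = r ^ (-s) := by rw [one_div, inv_rpow hr.le, rpow_neg hr.le]
  have hpos : 0 < r ^ (-s) * Gamma s := mul_pos (rpow_pos_of_pos hr _) (Gamma_pos_of_pos hs)
  rw [hr', ← integral_comp_rpow_Ioi _ (p := -1) (by norm_num)] at h
  have h2 : ∫ t in Ioi (0 : ℝ), t ^ (-s - 1) * exp (-(r / t)) = r ^ (-s) * Gamma s := by
    rw [← h]
    refine setIntegral_congr_fun measurableSet_Ioi fun t (ht : 0 < t) ↦ ?_
    simp only [abs_neg, abs_one, one_mul, smul_eq_mul, ← mul_assoc]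
    rw [← rpow_mul ht.le, ← rpow_add ht, rpow_neg_one, div_eq_mul_inv]
    congr 2
    ring
  rw [← h2, ofReal_integral_eq_lintegral_ofReal]
  · exact .of_integral_ne_zero (by rw [h2]; exact hpos.ne')
  · filter_upwards [ae_restrict_mem measurableSet_Ioi] with t ht
    have : (0 : ℝ) < t := ht
    positivity

open Set in
theorem lintegral_rpow_mul_one_add_rpow_Ioi {p q : ℝ} (hp : 0 < p) (hq : 0 < q) :
    ∫⁻ t in Ioi (0 : ℝ), ENNReal.ofReal (t ^ (p - 1) * (1 + t) ^ (-(p + q))) =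
      ENNReal.ofReal (Gamma p * Gamma q / Gamma (p + q)) := by
  have hpq : 0 < p + q := add_pos hp hq
  have hΓ := Gamma_pos_of_pos hpq
  calc ∫⁻ t in Ioi (0 : ℝ), ENNReal.ofReal (t ^ (p - 1) * (1 + t) ^ (-(p + q)))
      = ∫⁻ t in Ioi (0 : ℝ), ∫⁻ u in Ioi (0 : ℝ), ENNReal.ofReal
          (t ^ (p - 1) * (u ^ (p + q - 1) * exp (-((1 + t) * u))) / Gamma (p + q)) := by
        refine setLIntegral_congr_fun measurableSet_Ioi fun t (ht : 0 < t) ↦ ?_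
        have hc : 0 ≤ t ^ (p - 1) / Gamma (p + q) := by positivity
        have := lintegral_rpow_mul_exp_neg_mul_Ioi hpq (r := 1 + t) (by positivity)
        simp_rw [mul_div_right_comm (t ^ (p - 1)), ENNReal.ofReal_mul hc]
        rw [lintegral_const_mul _ (by fun_prop), this, ← ENNReal.ofReal_mul hc]
        congr 1
        field_simp
    _ = ∫⁻ u in Ioi (0 : ℝ), ∫⁻ t in Ioi (0 : ℝ), ENNReal.ofReal
          (t ^ (p - 1) * (u ^ (p + q - 1) * exp (-((1 + t) * u))) / Gamma (p + q)) :=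
        lintegral_lintegral_swap (by fun_prop)
    _ = ∫⁻ u in Ioi (0 : ℝ), ENNReal.ofReal (Gamma p / Gamma (p + q)) *
          ENNReal.ofReal (u ^ (q - 1) * exp (-(1 * u))) := by
        refine setLIntegral_congr_fun measurableSet_Ioi fun u (hu : 0 < u) ↦ ?_
        have hc : 0 ≤ u ^ (p + q - 1) * exp (-u) / Gamma (p + q) := by positivity
        have := lintegral_rpow_mul_exp_neg_mul_Ioi hp hu
        have e (t : ℝ) : t ^ (p - 1) * (u ^ (p + q - 1) * exp (-((1 + t) * u))) / Gamma (p + q)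
            = u ^ (p + q - 1) * exp (-u) / Gamma (p + q) * (t ^ (p - 1) * exp (-(u * t))) := by
          rw [show -((1 + t) * u) = -u + -(u * t) by ring, exp_add]
          ring
        simp_rw [e, ENNReal.ofReal_mul hc]
        rw [lintegral_const_mul _ (by fun_prop), this, ← ENNReal.ofReal_mul hc,
          ← ENNReal.ofReal_mul (by positivity)]
        congr 1
        rw [show q - 1 = (p + q - 1) + -p by ring, rpow_add hu, one_mul]
        ring
    _ = _ := by
        rw [lintegral_const_mul _ (by fun_prop), lintegral_rpow_mul_exp_neg_mul_Ioi hq one_pos,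
          ← ENNReal.ofReal_mul (by positivity)]
        simp [mul_div_right_comm]

theorem rpow_le_one_add_pow_ceil {x α : ℝ} (hx : 0 ≤ x) (hα : 0 ≤ α) :
    x ^ α ≤ 1 + x ^ ⌈α⌉₊ := by
  rcases le_total x 1 with h | h
  · exact (rpow_le_one hx h hα).trans (le_add_of_nonneg_right (by positivity))
  · rw [← rpow_natCast x]
    exact (rpow_le_rpow_of_exponent_le h (Nat.le_ceil α)).trans
      (le_add_of_nonneg_left zero_le_one)

theorem SchwartzMap.exists_rpow_norm_mul_norm_le {V : Type*} [NormedAddCommGroup V] [NormedSpace ℝ V]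
    (f : SchwartzMap V ℂ) {α : ℝ} (hα : 0 ≤ α) :
    ∃ C, ∀ x, ‖x‖ ^ α * ‖f x‖ ≤ C := by
  obtain ⟨C₀, -, hC₀⟩ := f.decay 0 0
  obtain ⟨C, -, hC⟩ := f.decay ⌈α⌉₊ 0
  refine ⟨C₀ + C, fun x ↦ ?_⟩
  have h₀ := hC₀ x
  have h := hC x
  simp only [norm_iteratedFDeriv_zero, pow_zero, one_mul] at h₀ h
  calc ‖x‖ ^ α * ‖f x‖ ≤ (1 + ‖x‖ ^ ⌈α⌉₊) * ‖f x‖ := by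
        gcongr
        exact rpow_le_one_add_pow_ceil (norm_nonneg x) hα
    _ ≤ C₀ + C := by linarith

theorem SchwartzMap.continuous_rpow_norm_mul {V : Type*} [NormedAddCommGroup V] [NormedSpace ℝ V]
    (f : SchwartzMap V ℂ) {α : ℝ} (hα : 0 ≤ α) :
    Continuous fun x ↦ ((‖x‖ ^ α : ℝ) : ℂ) * f x :=
  (Complex.continuous_ofReal.comp (continuous_norm.rpow_const fun _ ↦ .inr hα)).mul f.continuous

section

variable {V : Type*} [NormedAddCommGroup V] [InnerProductSpace ℝ V] [FiniteDimensional ℝ V]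
  [MeasurableSpace V] [BorelSpace V]

theorem lintegral_exp_neg_mul_sq_norm {b : ℝ} (hb : 0 < b) :
    ∫⁻ v : V, ENNReal.ofReal (exp (-b * ‖v‖ ^ 2)) =
      ENNReal.ofReal ((π / b) ^ (Module.finrank ℝ V / 2 : ℝ)) := by
  have h := GaussianFourier.integral_rexp_neg_mul_sq_norm (V := V) hb
  rw [← h, ofReal_integral_eq_lintegral_ofReal]
  · exact .of_integral_ne_zero (by rw [h]; positivity)
  · exact .of_forall fun _ ↦ by positivity

theorem lintegral_exp_sq_norm_sub_mul_exp_sq_norm {p q : ℝ} (hp : 0 < p) (hq : 0 < q) (x : V) :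
    ∫⁻ y : V, ENNReal.ofReal (exp (-p * ‖x - y‖ ^ 2) * exp (-q * ‖y‖ ^ 2)) =
      ENNReal.ofReal ((π / (p + q)) ^ (Module.finrank ℝ V / 2 : ℝ) *
        exp (-(p * q / (p + q) * ‖x‖ ^ 2))) := by
  have hpq : 0 < p + q := add_pos hp hq
  have e (y : V) : exp (-p * ‖x - y‖ ^ 2) * exp (-q * ‖y‖ ^ 2) =
      exp (-(p * q / (p + q) * ‖x‖ ^ 2)) * exp (-(p + q) * ‖y - (p / (p + q)) • x‖ ^ 2) := by
    rw [← exp_add, ← exp_add]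
    congr 1
    rw [norm_sub_sq_real, norm_sub_sq_real, inner_smul_right, norm_smul, real_inner_comm x y,
      norm_of_nonneg (by positivity)]
    field_simp
    ring
  simp_rw [e, ENNReal.ofReal_mul (exp_nonneg _)]
  rw [lintegral_const_mul _ (by fun_prop),
    lintegral_sub_right_eq_self (fun y : V ↦ ENNReal.ofReal (exp (-(p + q) * ‖y‖ ^ 2))),
    lintegral_exp_neg_mul_sq_norm hpq, ← ENNReal.ofReal_mul (exp_nonneg _), mul_comm]

open Set in
theorem lintegral_gaussian_mul_rpow_norm {p q : ℝ} (hp : 0 < p) (hq : 0 < q)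
    (hpq : (Module.finrank ℝ V / 2 : ℝ) = p + 2 * q) {x : V} (hx : x ≠ 0) :
    ∫⁻ t in Ioi (0 : ℝ), ∫⁻ y : V, ENNReal.ofReal
      (t ^ (p - 1) * (t ^ (-(p + 2 * q)) * exp (-(π / t) * ‖x - y‖ ^ 2)) *
        ‖y‖ ^ (-(2 * (p + q)))) =
      ENNReal.ofReal (π ^ p * Gamma p * Gamma q ^ 2 / Gamma (p + q) ^ 2 * ‖x‖ ^ (-(2 * q))) := by
  have hb : 0 < p + q := add_pos hp hq
  have hΓ := Gamma_pos_of_pos hb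
  have hx' : 0 < ‖x‖ := norm_pos_iff.2 hx
  have : Nontrivial V := ⟨x, 0, hx⟩
  calc _ = ∫⁻ t in Ioi (0 : ℝ), ∫⁻ y : V, ∫⁻ s in Ioi (0 : ℝ), ENNReal.ofReal
        (π ^ (p + q) / Gamma (p + q) * t ^ (-(p + 3 * q) - 1) * s ^ (p + q - 1) *
          (exp (-(π / t) * ‖x - y‖ ^ 2) * exp (-(π / t * s) * ‖y‖ ^ 2))) := by
        refine setLIntegral_congr_fun measurableSet_Ioi fun t (ht : 0 < t) ↦ ?_
        refine lintegral_congr_ae ?_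
        filter_upwards [Measure.ae_ne volume (0 : V)] with y hy
        have hy' : 0 < ‖y‖ := norm_pos_iff.2 hy
        have h := lintegral_rpow_mul_exp_neg_mul_Ioi hb (r := π * ‖y‖ ^ 2 / t) (by positivity)
        set c := π ^ (p + q) / Gamma (p + q) * t ^ (-(p + 3 * q) - 1) *
          exp (-(π / t) * ‖x - y‖ ^ 2) with hc
        have hc0 : 0 ≤ c := by positivity
        have e (s : ℝ) : π ^ (p + q) / Gamma (p + q) * t ^ (-(p + 3 * q) - 1) * s ^ (p + q - 1) *
          (exp (-(π / t) * ‖x - y‖ ^ 2) * exp (-(π / t * s) * ‖y‖ ^ 2)) =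
            c * (s ^ (p + q - 1) * exp (-(π * ‖y‖ ^ 2 / t * s))) := by
          rw [hc, show -(π * ‖y‖ ^ 2 / t * s) = -(π / t * s) * ‖y‖ ^ 2 by ring]
          ring
        simp_rw [e, ENNReal.ofReal_mul hc0]
        rw [lintegral_const_mul _ (by fun_prop), h, ← ENNReal.ofReal_mul hc0, hc]
        congr 1
        rw [div_rpow (by positivity) ht.le, mul_rpow pi_pos.le (by positivity),
          ← rpow_natCast ‖y‖ 2, ← rpow_mul hy'.le, rpow_neg pi_pos.le,
          show t ^ (-(p + 3 * q) - 1) = t ^ (p - 1) * t ^ (-(p + 2 * q)) * t ^ (-(p + q)) by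
            rw [← rpow_add ht, ← rpow_add ht]; congr 1; ring,
          show ((2 : ℕ) : ℝ) * -(p + q) = -(2 * (p + q)) by push_cast; ring]
        have := rpow_pos_of_pos ht (-(p + q))
        have := rpow_pos_of_pos pi_pos (p + q)
        field_simp
    _ = ∫⁻ t in Ioi (0 : ℝ), ∫⁻ s in Ioi (0 : ℝ), ∫⁻ y : V, ENNReal.ofReal
        (π ^ (p + q) / Gamma (p + q) * t ^ (-(p + 3 * q) - 1) * s ^ (p + q - 1) *
          (exp (-(π / t) * ‖x - y‖ ^ 2) * exp (-(π / t * s) * ‖y‖ ^ 2))) := by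
        refine lintegral_congr fun t ↦ lintegral_lintegral_swap (by fun_prop)
    _ = ∫⁻ t in Ioi (0 : ℝ), ∫⁻ s in Ioi (0 : ℝ), ENNReal.ofReal
        (π ^ (p + q) / Gamma (p + q) * s ^ (p + q - 1) * (1 + s) ^ (-(p + 2 * q)) *
          (t ^ (-q - 1) * exp (-(π * s / (1 + s) * ‖x‖ ^ 2 / t)))) := by
        refine setLIntegral_congr_fun measurableSet_Ioi fun t (ht : 0 < t) ↦ ?_
        refine setLIntegral_congr_fun measurableSet_Ioi fun s (hs : 0 < s) ↦ ?_
        have hc : 0 ≤ π ^ (p + q) / Gamma (p + q) * t ^ (-(p + 3 * q) - 1) * s ^ (p + q - 1) := by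
          positivity
        simp_rw [ENNReal.ofReal_mul hc]
        rw [lintegral_const_mul _ (by fun_prop), lintegral_exp_sq_norm_sub_mul_exp_sq_norm
          (by positivity) (by positivity), ← ENNReal.ofReal_mul hc, hpq]
        congr 1
        rw [show π / (π / t + π / t * s) = t / (1 + s) by field_simp,
          show π / t * (π / t * s) / (π / t + π / t * s) * ‖x‖ ^ 2 =
            π * s / (1 + s) * ‖x‖ ^ 2 / t by field_simp,
          div_rpow ht.le (by positivity), rpow_neg (by positivity : 0 ≤ 1 + s),
          show t ^ (-q - 1) = t ^ (-(p + 3 * q) - 1) * t ^ (p + 2 * q) by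
            rw [← rpow_add ht]; congr 1; ring]
        ring
    _ = ∫⁻ s in Ioi (0 : ℝ), ∫⁻ t in Ioi (0 : ℝ), ENNReal.ofReal
        (π ^ (p + q) / Gamma (p + q) * s ^ (p + q - 1) * (1 + s) ^ (-(p + 2 * q)) *
          (t ^ (-q - 1) * exp (-(π * s / (1 + s) * ‖x‖ ^ 2 / t)))) :=
        lintegral_lintegral_swap (by fun_prop)
    _ = ∫⁻ s in Ioi (0 : ℝ), ENNReal.ofReal
          (π ^ p * Gamma q / Gamma (p + q) * ‖x‖ ^ (-(2 * q))) *
            ENNReal.ofReal (s ^ (p - 1) * (1 + s) ^ (-(p + q))) := by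
        refine setLIntegral_congr_fun measurableSet_Ioi fun s (hs : 0 < s) ↦ ?_
        have hc : 0 ≤ π ^ (p + q) / Gamma (p + q) * s ^ (p + q - 1) * (1 + s) ^ (-(p + 2 * q)) := by
          positivity
        have hs1 : 0 < 1 + s := by positivity
        simp_rw [ENNReal.ofReal_mul hc]
        rw [lintegral_const_mul _ (by fun_prop), lintegral_rpow_mul_exp_neg_div_Ioi hq
          (by positivity), ← ENNReal.ofReal_mul hc, ← ENNReal.ofReal_mul (by positivity)]
        congr 1
        rw [mul_rpow (by positivity) (by positivity), div_rpow (by positivity) hs1.le,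
          mul_rpow pi_pos.le hs.le, ← rpow_natCast ‖x‖ 2, ← rpow_mul hx'.le,
          show ((2 : ℕ) : ℝ) * -q = -(2 * q) by push_cast; ring,
          show π ^ p = π ^ (p + q) * π ^ (-q) by rw [← rpow_add pi_pos]; congr 1; ring,
          show s ^ (p - 1) = s ^ (p + q - 1) * s ^ (-q) by rw [← rpow_add hs]; congr 1; ring,
          show (1 + s) ^ (-(p + q)) = (1 + s) ^ (-(p + 2 * q)) / (1 + s) ^ (-q) by
            rw [← rpow_sub hs1]; congr 1; ring]
        ring
    _ = _ := by
        rw [lintegral_const_mul _ (by fun_prop), lintegral_rpow_mul_one_add_rpow_Ioi hp hq,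
          ← ENNReal.ofReal_mul (by positivity)]
        congr 1
        ring

open Set in
theorem lintegral_gaussian_mul_mul_le {p q : ℝ} (hp : 0 < p) (hq : 0 < q)
    (hpq : (Module.finrank ℝ V / 2 : ℝ) = p + 2 * q) {u : V → ℝ} (hu : Measurable u) :
    ∫⁻ t in Ioi (0 : ℝ), ∫⁻ x : V, ∫⁻ y : V, ENNReal.ofReal
      (t ^ (p - 1) * (t ^ (-(p + 2 * q)) * exp (-(π / t) * ‖x - y‖ ^ 2)) * (u x * u y)) ≤
      ENNReal.ofReal (π ^ p * Gamma p * Gamma q ^ 2 / Gamma (p + q) ^ 2) *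
        ∫⁻ x : V, ENNReal.ofReal (‖x‖ ^ (2 * p) * u x ^ 2) := by
  have : Nontrivial V := by
    apply Module.nontrivial_of_finrank_pos (R := ℝ)
    have : (0 : ℝ) < Module.finrank ℝ V := by linarith
    exact_mod_cast this
  have hne : ∀ᵐ x : V, x ≠ 0 := Measure.ae_ne volume (0 : V)
  let F (t : ℝ) (x y : V) : ENNReal := ENNReal.ofReal
    (t ^ (p - 1) * (t ^ (-(p + 2 * q)) * exp (-(π / t) * ‖x - y‖ ^ 2)) * ‖y‖ ^ (-(2 * (p + q))) *
      (‖x‖ ^ (2 * (p + q)) * u x ^ 2))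
  have hF : ∀ t ∈ Ioi (0 : ℝ), ∫⁻ x : V, ∫⁻ y : V, ENNReal.ofReal
      (t ^ (p - 1) * (t ^ (-(p + 2 * q)) * exp (-(π / t) * ‖x - y‖ ^ 2)) * (u x * u y)) ≤
      ∫⁻ x : V, ∫⁻ y : V, F t x y := by
    intro t (ht : 0 < t)
    rw [← ENNReal.mul_le_mul_iff_right two_ne_zero ENNReal.ofNat_ne_top]
    calc _ = ∫⁻ x : V, ∫⁻ y : V, ENNReal.ofReal
          (2 * (t ^ (p - 1) * (t ^ (-(p + 2 * q)) * exp (-(π / t) * ‖x - y‖ ^ 2)) *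
            (u x * u y))) := by
          simp_rw [ENNReal.ofReal_mul zero_le_two, ENNReal.ofReal_ofNat]
          rw [← lintegral_const_mul _ (by fun_prop)]
          congr with x
          rw [← lintegral_const_mul _ (by fun_prop)]
      _ ≤ ∫⁻ x : V, ∫⁻ y : V, (F t x y + F t y x) := by
          refine lintegral_mono_ae ?_
          filter_upwards [hne] with x hx
          refine lintegral_mono_ae ?_
          filter_upwards [hne] with y hy
          have hx' : 0 < ‖x‖ := norm_pos_iff.2 hx
          have hy' : 0 < ‖y‖ := norm_pos_iff.2 hy
          rw [← ENNReal.ofReal_add (by positivity) (by positivity)]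
          apply ENNReal.ofReal_le_ofReal
          rw [norm_sub_rev y x]
          set k := t ^ (p - 1) * (t ^ (-(p + 2 * q)) * exp (-(π / t) * ‖x - y‖ ^ 2))
          have hk : 0 ≤ k := by positivity
          set X := ‖x‖ ^ (p + q) with hX
          set Y := ‖y‖ ^ (p + q) with hY
          have hX0 : 0 < X := by positivity
          have hY0 : 0 < Y := by positivity
          have e {z : V} (hz : 0 < ‖z‖) : ‖z‖ ^ (2 * (p + q)) = (‖z‖ ^ (p + q)) ^ 2 := by
            rw [← rpow_natCast (_ ^ _), ← rpow_mul hz.le, mul_comm, Nat.cast_ofNat]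
          rw [rpow_neg hx'.le, rpow_neg hy'.le, e hx', e hy', ← hX, ← hY]
          have := two_mul_le_add_sq (Y⁻¹ * X * u x) (X⁻¹ * Y * u y)
          calc _ = k * (2 * (Y⁻¹ * X * u x) * (X⁻¹ * Y * u y)) := by field_simp
            _ ≤ k * ((Y⁻¹ * X * u x) ^ 2 + (X⁻¹ * Y * u y) ^ 2) := by gcongr
            _ = _ := by field_simp
      _ = (∫⁻ x : V, ∫⁻ y : V, F t x y) + ∫⁻ x : V, ∫⁻ y : V, F t y x := by
          rw [← lintegral_add_left (by fun_prop)]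
          congr with x
          rw [← lintegral_add_left (by fun_prop)]
      _ = _ := by
          rw [lintegral_lintegral_swap (f := fun x y ↦ F t y x) (by fun_prop), two_mul]
  refine (setLIntegral_mono' measurableSet_Ioi hF).trans_eq ?_
  rw [lintegral_lintegral_swap (by fun_prop), ← lintegral_const_mul _ (by fun_prop)]
  refine lintegral_congr_ae ?_
  filter_upwards [hne] with x hx
  have hx' : 0 < ‖x‖ := norm_pos_iff.2 hx
  have hc : 0 ≤ ‖x‖ ^ (2 * (p + q)) * u x ^ 2 := by positivity
  simp only [F]
  simp_rw [ENNReal.ofReal_mul' hc]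
  rw [lintegral_congr fun t ↦ lintegral_mul_const _ (by fun_prop),
    lintegral_mul_const _ (by fun_prop), lintegral_gaussian_mul_rpow_norm hp hq hpq hx,
    ← ENNReal.ofReal_mul' hc, ← ENNReal.ofReal_mul' (by positivity)]
  congr 1
  rw [show ‖x‖ ^ (2 * p) = ‖x‖ ^ (-(2 * q)) * ‖x‖ ^ (2 * (p + q)) by
    rw [← rpow_add hx']; congr 1; ring]
  ring


open ComplexConjugate in
theorem integral_mul_sq_norm_fourierInv {φ h : V → ℂ} (hφ : Integrable φ) (hh : Integrable h) :
    ∫ x, φ x * ((‖𝓕⁻ h x‖ ^ 2 : ℝ) : ℂ) =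
      ∫ z : V × V, 𝓕 φ (z.2 - z.1) * (h z.1 * conj (h z.2)) := by
  let G (x : V) (z : V × V) : ℂ :=
    φ x * ((𝐞 (inner ℝ z.1 x) : ℂ) * h z.1 * conj ((𝐞 (inner ℝ z.2 x) : ℂ) * h z.2))
  have hG (x : V) (z : V × V) :
      G x z = ((𝐞 (-inner ℝ x (z.2 - z.1)) : ℂ) * φ x) * (h z.1 * conj (h z.2)) := by
    have : (𝐞 (-inner ℝ x (z.2 - z.1)) : ℂ) =
        (𝐞 (inner ℝ z.1 x) : ℂ) * conj (𝐞 (inner ℝ z.2 x) : ℂ) := by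
      rw [← Circle.coe_inv_eq_conj, ← AddChar.map_neg_eq_inv, ← Circle.coe_mul,
        ← AddChar.map_add_eq_mul, inner_sub_right, real_inner_comm z.1, real_inner_comm z.2]
      congr 2
      ring
    simp only [G, this, map_mul]
    ring
  have hconj : Integrable (fun x ↦ conj (h x)) :=
    Complex.conjCLE.toContinuousLinearMap.integrable_comp hh
  have h_int : Integrable (Function.uncurry G) (volume.prod volume) := by
    have h0 : Integrable (fun w : V × V × V ↦ φ w.1 * (h w.2.1 * conj (h w.2.2)))
        (volume.prod (volume.prod volume)) := hφ.mul_prod (hh.mul_prod hconj)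
    have hcont : Continuous fun w : V × V × V ↦ (𝐞 (-inner ℝ w.1 (w.2.2 - w.2.1)) : ℂ) := by
      fun_prop
    refine (h0.bdd_mul (c := 1) hcont.aestronglyMeasurable
      (.of_forall fun w ↦ (Circle.norm_coe _).le)).congr (.of_forall fun w ↦ ?_)
    simp only [Function.uncurry, hG]
    ring
  calc ∫ x, φ x * ((‖𝓕⁻ h x‖ ^ 2 : ℝ) : ℂ) = ∫ x, ∫ z, G x z := by
        congr with x
        simp only [G]
        rw [integral_const_mul, Measure.volume_eq_prod, integral_prod_mul
          (fun y ↦ (𝐞 (inner ℝ y x) : ℂ) * h y) fun y ↦ conj ((𝐞 (inner ℝ y x) : ℂ) * h y),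
          integral_conj, Complex.mul_conj, Complex.normSq_eq_norm_sq, fourierInv_eq]
        simp only [Circle.smul_def, smul_eq_mul]
    _ = ∫ z, ∫ x, G x z := integral_integral_swap h_int
    _ = _ := by
        congr with z
        simp only [hG]
        rw [integral_mul_const, Real.fourier_eq]
        simp only [Circle.smul_def, smul_eq_mul]

theorem continuous_fourierInv {h : V → ℂ} (hh : Integrable h) : Continuous (𝓕⁻ h) := by
  rw [show 𝓕⁻ h = fun x ↦ 𝓕 h (-x) from funext fun x ↦ fourierInv_eq_fourier_neg h x]
  exact (VectorFourier.fourierIntegral_continuous continuous_fourierChar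
    continuous_inner hh).comp continuous_neg

theorem norm_fourierInv_le_integral_norm (h : V → ℂ) (x : V) : ‖𝓕⁻ h x‖ ≤ ∫ y, ‖h y‖ := by
  rw [fourierInv_eq_fourier_neg]
  exact VectorFourier.norm_fourierIntegral_le_integral_norm _ _ _ _ _

theorem lintegral_exp_neg_mul_sq_norm_fourierInv_le {t : ℝ} (ht : 0 < t) {h : V → ℂ}
    (hh : Integrable h) :
    ∫⁻ x, ENNReal.ofReal (exp (-(π * ‖x‖ ^ 2 * t)) * ‖𝓕⁻ h x‖ ^ 2) ≤
      ∫⁻ x : V, ∫⁻ y : V, ENNReal.ofReal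
        (t ^ (-(Module.finrank ℝ V / 2 : ℝ)) * exp (-(π / t) * ‖x - y‖ ^ 2) *
          (‖h x‖ * ‖h y‖)) := by
  have hb : 0 < π * t := by positivity
  let φ (x : V) : ℂ := Complex.exp (-(π * t : ℝ) * ‖x‖ ^ 2)
  have hφe (x : V) : φ x = (exp (-(π * ‖x‖ ^ 2 * t)) : ℝ) := by
    simp only [φ]
    push_cast
    congr 1
    ring
  have hφ : Integrable φ := by
    have := GaussianFourier.integrable_cexp_neg_mul_sq_norm_add (V := V) (b := (π * t : ℝ))
      (by simpa using hb) 0 0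
    simpa [φ, neg_mul] using this
  have hF (w : V) : 𝓕 φ w =
      (t ^ (-(Module.finrank ℝ V / 2 : ℝ)) * exp (-(π / t) * ‖w‖ ^ 2) : ℝ) := by
    rw [fourier_gaussian_innerProductSpace (by simpa using hb)]
    rw [rpow_neg ht.le, ← inv_rpow ht.le]
    push_cast
    rw [Complex.ofReal_cpow (by positivity)]
    push_cast
    congr 2
    · field_simp
    · field_simp
  have h_int : Integrable fun x ↦ exp (-(π * ‖x‖ ^ 2 * t)) * ‖𝓕⁻ h x‖ ^ 2 := by
    have hexp : Integrable fun x : V ↦ exp (-(π * ‖x‖ ^ 2 * t)) := by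
      refine hφ.norm.congr (.of_forall fun x ↦ ?_)
      simp only [hφe, Complex.norm_real, norm_of_nonneg (exp_nonneg _)]
    refine hexp.mul_bdd (c := (∫ y, ‖h y‖) ^ 2)
      ((continuous_fourierInv hh).norm.pow 2).aestronglyMeasurable (.of_forall fun x ↦ ?_)
    rw [norm_of_nonneg (by positivity)]
    gcongr
    exact norm_fourierInv_le_integral_norm h x
  have key := integral_mul_sq_norm_fourierInv hφ hh
  simp_rw [hφe, ← Complex.ofReal_mul] at key
  rw [integral_complex_ofReal] at key
  rw [← ofReal_integral_eq_lintegral_ofReal h_int (.of_forall fun x ↦ by positivity)]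
  calc _ ≤ ‖((∫ x, exp (-(π * ‖x‖ ^ 2 * t)) * ‖𝓕⁻ h x‖ ^ 2 : ℝ) : ℂ)‖ₑ := by
        rw [← ofReal_norm, Complex.norm_real]
        exact ENNReal.ofReal_le_ofReal (le_abs_self _)
    _ ≤ ∫⁻ z : V × V, ENNReal.ofReal
        (t ^ (-(Module.finrank ℝ V / 2 : ℝ)) * exp (-(π / t) * ‖z.1 - z.2‖ ^ 2) *
          (‖h z.1‖ * ‖h z.2‖)) := by
        rw [key]
        refine (enorm_integral_le_lintegral_enorm _).trans_eq (lintegral_congr fun z ↦ ?_)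
        rw [← ofReal_norm, norm_mul, norm_mul, RCLike.norm_conj, hF, Complex.norm_real,
          norm_of_nonneg (by positivity), norm_sub_rev]
    _ = _ := by
        have h1 : AEMeasurable (fun z : V × V ↦ ‖h z.1‖) (volume.prod volume) :=
          hh.1.comp_fst.norm.aemeasurable
        have h2 : AEMeasurable (fun z : V × V ↦ ‖h z.2‖) (volume.prod volume) :=
          hh.1.comp_snd.norm.aemeasurable
        rw [Measure.volume_eq_prod, lintegral_prod _ (by fun_prop)]

theorem eLpNorm_fourierInv_eq {g : V → ℂ} (hg : Integrable g) (hg2 : MemLp g 2) :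
    eLpNorm (𝓕⁻ g) 2 = eLpNorm g 2 := by
  let G : Lp ℂ 2 (volume : Measure V) := hg2.toLp g
  have hae : (𝓕⁻ G : Lp ℂ 2 (volume : Measure V)) =ᵐ[volume] 𝓕⁻ g := by
    refine ae_eq_of_integral_contDiff_smul_eq ((Lp.memLp _).locallyIntegrable (by norm_num))
      (continuous_fourierInv hg).locallyIntegrable fun φ hφ hφc ↦ ?_
    let Φ : SchwartzMap V ℂ := (hφc.comp_left (g := ((↑) : ℝ → ℂ)) rfl).toSchwartzMap
      (Complex.ofRealCLM.contDiff.comp hφ)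
    have hΦ (x : V) : Φ x = φ x := rfl
    have h1 := DFunLike.congr_fun (Lp.fourierInv_toTemperedDistribution_eq G) Φ
    rw [TemperedDistribution.fourierInv_apply, Lp.toTemperedDistribution_apply,
      Lp.toTemperedDistribution_apply] at h1
    have h2 : ∫ x, (𝓕⁻ Φ) x • G x = ∫ x, (𝓕⁻ Φ) x • g x :=
      integral_congr_ae (by filter_upwards [hg2.coeFn_toLp] with x hx; rw [hx])
    have h3 : ∫ x, (𝓕⁻ Φ) x • g x = ∫ x, Φ x • 𝓕⁻ g x := by
      have := VectorFourier.integral_fourierIntegral_smul_eq_flip (L := -innerₗ V)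
        (μ := volume) (ν := volume) (f := Φ) (g := g) continuous_fourierChar
        (by simpa using! continuous_inner.neg) Φ.integrable hg
      have hflip : (-innerₗ V).flip = -innerₗ V := by
        ext v w
        simp [real_inner_comm]
      rw [hflip] at this
      simpa only [SchwartzMap.fourierInv_coe] using! this
    rw [h2, h3] at h1
    simpa [hΦ] using h1.symm
  rw [← eLpNorm_congr_ae hae, ← eLpNorm_congr_ae hg2.coeFn_toLp]
  have h : ‖𝓕⁻ G‖ = ‖G‖ := (Lp.fourierTransformₗᵢ V ℂ).symm.norm_map G
  rw [Lp.norm_def, Lp.norm_def, ENNReal.toReal_eq_toReal_iff' (Lp.eLpNorm_ne_top _)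
    (Lp.eLpNorm_ne_top _)] at h
  exact h

open Set in
/-- The **Herbst inequality**, or fractional Hardy inequality, with its sharp constant. -/
theorem lintegral_rpow_norm_mul_sq_norm_fourierInv_le {α : ℝ} (hα : 0 < α)
    (hαd : α < (Module.finrank ℝ V : ℝ) / 2) {h : V → ℂ} (hh : Integrable h)
    (hm : Measurable h) :
    ∫⁻ x : V, ENNReal.ofReal (‖x‖ ^ (-(2 * α)) * ‖𝓕⁻ h x‖ ^ 2) ≤
      ENNReal.ofReal (Gamma (((Module.finrank ℝ V : ℝ) - 2 * α) / 4) ^ 2 /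
        (2 ^ (2 * α) * Gamma (((Module.finrank ℝ V : ℝ) + 2 * α) / 4) ^ 2)) *
        ∫⁻ ξ : V, ENNReal.ofReal ((2 * π * ‖ξ‖) ^ (2 * α) * ‖h ξ‖ ^ 2) := by
  have hd : (0 : ℝ) < Module.finrank ℝ V := by linarith
  have : Nontrivial V := Module.nontrivial_of_finrank_pos (R := ℝ) (by exact_mod_cast hd)
  set q := ((Module.finrank ℝ V : ℝ) - 2 * α) / 4 with hq_def
  have hq : 0 < q := by rw [hq_def]; linarith
  have hpq : (Module.finrank ℝ V / 2 : ℝ) = α + 2 * q := by rw [hq_def]; ring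
  rw [show ((Module.finrank ℝ V : ℝ) + 2 * α) / 4 = α + q by rw [hq_def]; ring]
  have hΓα := Gamma_pos_of_pos hα
  have hΓ := Gamma_pos_of_pos (add_pos hα hq)
  have hc : 0 ≤ π ^ α / Gamma α := by positivity
  have hcont := continuous_fourierInv hh
  calc ∫⁻ x : V, ENNReal.ofReal (‖x‖ ^ (-(2 * α)) * ‖𝓕⁻ h x‖ ^ 2)
      = ∫⁻ x : V, ∫⁻ t in Ioi (0 : ℝ), ENNReal.ofReal (π ^ α / Gamma α) * ENNReal.ofReal
          (t ^ (α - 1) * (exp (-(π * ‖x‖ ^ 2 * t)) * ‖𝓕⁻ h x‖ ^ 2)) := by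
        refine lintegral_congr_ae ?_
        filter_upwards [Measure.ae_ne volume (0 : V)] with x hx
        have hx' : 0 < ‖x‖ := norm_pos_iff.2 hx
        simp_rw [← mul_assoc (_ ^ (α - 1)),
          ENNReal.ofReal_mul' (sq_nonneg ‖𝓕⁻ h x‖)]
        rw [lintegral_const_mul _ (by fun_prop), lintegral_mul_const _ (by fun_prop),
          lintegral_rpow_mul_exp_neg_mul_Ioi hα (by positivity), ← mul_assoc,
          ← ENNReal.ofReal_mul hc]
        congr 2
        rw [mul_rpow pi_pos.le (by positivity), ← rpow_natCast ‖x‖ 2, ← rpow_mul hx'.le,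
          show ((2 : ℕ) : ℝ) * -α = -(2 * α) by push_cast; ring, rpow_neg pi_pos.le]
        field_simp
    _ = ∫⁻ t in Ioi (0 : ℝ), ∫⁻ x : V, ENNReal.ofReal (π ^ α / Gamma α) * ENNReal.ofReal
          (t ^ (α - 1) * (exp (-(π * ‖x‖ ^ 2 * t)) * ‖𝓕⁻ h x‖ ^ 2)) :=
        lintegral_lintegral_swap (by have := hcont.measurable; fun_prop)
    _ ≤ ∫⁻ t in Ioi (0 : ℝ), ENNReal.ofReal (π ^ α / Gamma α) * ∫⁻ x : V, ∫⁻ y : V,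
          ENNReal.ofReal (t ^ (α - 1) * (t ^ (-(α + 2 * q)) * exp (-(π / t) * ‖x - y‖ ^ 2)) *
            (‖h x‖ * ‖h y‖)) := by
        refine setLIntegral_mono' measurableSet_Ioi fun t (ht : 0 < t) ↦ ?_
        have hmeas := hcont.measurable
        have ht' : 0 ≤ t ^ (α - 1) := by positivity
        rw [lintegral_const_mul _ (by fun_prop)]
        simp_rw [mul_assoc (t ^ (α - 1)), ENNReal.ofReal_mul ht']
        rw [lintegral_const_mul _ (by fun_prop),
          lintegral_congr fun x ↦ lintegral_const_mul _ (by fun_prop),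
          lintegral_const_mul _ (by fun_prop), ← hpq]
        exact mul_le_mul' le_rfl
          (mul_le_mul' le_rfl (lintegral_exp_neg_mul_sq_norm_fourierInv_le ht hh))
    _ ≤ ENNReal.ofReal (π ^ α / Gamma α) *
          (ENNReal.ofReal (π ^ α * Gamma α * Gamma q ^ 2 / Gamma (α + q) ^ 2) *
            ∫⁻ x : V, ENNReal.ofReal (‖x‖ ^ (2 * α) * ‖h x‖ ^ 2)) := by
        rw [lintegral_const_mul _ (by fun_prop)]
        gcongr
        exact lintegral_gaussian_mul_mul_le hα hq hpq hm.norm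
    _ = _ := by
        have h2π : 0 ≤ (2 * π) ^ (2 * α) := by positivity
        have e (x : V) : (2 * π * ‖x‖) ^ (2 * α) * ‖h x‖ ^ 2 =
            (2 * π) ^ (2 * α) * (‖x‖ ^ (2 * α) * ‖h x‖ ^ 2) := by
          rw [mul_rpow (by positivity) (norm_nonneg _), mul_assoc]
        simp_rw [e, ENNReal.ofReal_mul h2π]
        rw [lintegral_const_mul _ (by fun_prop), ← mul_assoc, ← mul_assoc,
          ← ENNReal.ofReal_mul hc, ← ENNReal.ofReal_mul (by positivity)]
        congr 2
        rw [mul_rpow zero_le_two pi_pos.le, two_mul α, rpow_add pi_pos]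
        field_simp

theorem SchwartzMap.integrable_rpow_norm_mul (f : SchwartzMap V ℂ) {α : ℝ} (hα : 0 ≤ α) :
    Integrable fun x ↦ ((‖x‖ ^ α : ℝ) : ℂ) * f x := by
  refine (f.integrable.norm.add (f.integrable_pow_mul volume ⌈α⌉₊)).mono'
    (f.continuous_rpow_norm_mul hα).aestronglyMeasurable (.of_forall fun x ↦ ?_)
  rw [norm_mul, Complex.norm_real, norm_of_nonneg (by positivity)]
  calc ‖x‖ ^ α * ‖f x‖ ≤ (1 + ‖x‖ ^ ⌈α⌉₊) * ‖f x‖ := by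
        gcongr
        exact rpow_le_one_add_pow_ceil (norm_nonneg x) hα
    _ = _ := by simp [add_mul]

theorem SchwartzMap.memLp_two_rpow_norm_mul (f : SchwartzMap V ℂ) {α : ℝ} (hα : 0 ≤ α) :
    MemLp (fun x ↦ ((‖x‖ ^ α : ℝ) : ℂ) * f x) 2 := by
  have hmeas := (f.continuous_rpow_norm_mul hα).aestronglyMeasurable (μ := volume)
  obtain ⟨C, hC⟩ := f.exists_rpow_norm_mul_norm_le hα
  have h_int := f.integrable_rpow_norm_mul hα
  rw [memLp_two_iff_integrable_sq_norm hmeas]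
  simp_rw [sq]
  refine h_int.norm.mul_bdd (c := C) hmeas.norm (.of_forall fun x ↦ ?_)
  rw [norm_norm, norm_mul, Complex.norm_real, norm_of_nonneg (by positivity)]
  exact hC x

theorem eLpNorm_two_sq {E : Type*} [NormedAddCommGroup E] (f : V → E) :
    eLpNorm f 2 ^ 2 = ∫⁻ x, ENNReal.ofReal (‖f x‖ ^ 2) := by
  have := eLpNorm_nnreal_pow_eq_lintegral (f := f) (μ := volume) (p := 2) two_ne_zero
  simp only [NNReal.coe_ofNat, ENNReal.coe_ofNat, ENNReal.rpow_ofNat] at this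
  rw [this]
  congr with x
  rw [ENNReal.ofReal_pow (norm_nonneg _), ofReal_norm]

/-- The **Herbst inequality** for Schwartz functions, in terms of `L²` norms. -/
theorem SchwartzMap.eLpNorm_rpow_norm_mul_le (f : SchwartzMap V ℂ) {α : ℝ} (hα : 0 < α)
    (hαd : α < (Module.finrank ℝ V : ℝ) / 2) :
    eLpNorm (fun x ↦ ((‖x‖ ^ (-α) : ℝ) : ℂ) * f x) 2 ≤
      ENNReal.ofReal ((2 ^ (2 * α) * Gamma (((Module.finrank ℝ V : ℝ) + 2 * α) / 4) ^ 2 /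
        Gamma (((Module.finrank ℝ V : ℝ) - 2 * α) / 4) ^ 2) ^ (-(1 : ℝ) / 2)) *
      eLpNorm (fun ξ ↦ (((2 * π * ‖ξ‖) ^ α : ℝ) : ℂ) * 𝓕 (⇑f) ξ) 2 := by
  have key := lintegral_rpow_norm_mul_sq_norm_fourierInv_le hα hαd (𝓕 f).integrable
    (𝓕 f).continuous.measurable
  rw [← SchwartzMap.fourierInv_coe, FourierTransform.fourierInv_fourier_eq] at key
  rw [← ENNReal.pow_le_pow_left_iff two_ne_zero, mul_pow, eLpNorm_two_sq, eLpNorm_two_sq,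
    ← ENNReal.ofReal_pow (by positivity)]
  have e {r : ℝ} (hr : 0 ≤ r) (s : ℝ) (z : ℂ) : ‖((r ^ s : ℝ) : ℂ) * z‖ ^ 2 =
      r ^ (2 * s) * ‖z‖ ^ 2 := by
    rw [norm_mul, Complex.norm_real, norm_of_nonneg (by positivity), mul_pow, mul_comm 2 s,
      rpow_mul hr, rpow_ofNat]
  have e1 (x : V) := e (norm_nonneg x) (-α) (f x)
  have e2 (x : V) := e (by positivity : 0 ≤ 2 * π * ‖x‖) α (𝓕 (⇑f) x)
  simp_rw [e1, e2, mul_neg]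
  convert! key using 3
  rw [← rpow_natCast, ← rpow_mul (by positivity),
    show -(1 : ℝ) / 2 * ((2 : ℕ) : ℝ) = -1 by norm_num, rpow_neg_one, inv_div]

end

/-- For `0 < α < d/2`, `a ∈ ℝ` and a Schwartz function `f`, with `|p|^α f` the inverse
Fourier transform of `ξ ↦ (2π|ξ|)^α 𝓕f(ξ)`, one has
`‖|p|^α f + a |x|^{-α} f‖_{L²} ≤ (1 + |a| 𝓗_{d,2α}^{-1/2}) ‖|p|^α f‖_{L²}`, where
`𝓗_{d,2α} = 2^{2α} Γ((d+2α)/4)² / Γ((d-2α)/4)²`. -/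
theorem hardy_upper_bound (d : ℕ) (hd : 1 ≤ d) (α : ℝ) (hα : 0 < α)
    (hαd : α < (d : ℝ) / 2) (a : ℝ) (f : SchwartzMap (EuclideanSpace ℝ (Fin d)) ℂ) :
    eLpNorm (fun x : EuclideanSpace ℝ (Fin d) =>
        𝓕⁻ (fun ξ : EuclideanSpace ℝ (Fin d) =>
            (((2 * π * ‖ξ‖) ^ α : ℝ) : ℂ) * 𝓕 (⇑f) ξ) x
          + ((a * ‖x‖ ^ (-α) : ℝ) : ℂ) * f x) 2 volume
      ≤ ENNReal.ofReal
          (1 + |a| * (2 ^ (2 * α) * Real.Gamma (((d : ℝ) + 2 * α) / 4) ^ 2 /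
              Real.Gamma (((d : ℝ) - 2 * α) / 4) ^ 2) ^ (-(1 : ℝ) / 2)) *
        eLpNorm (fun x : EuclideanSpace ℝ (Fin d) =>
          𝓕⁻ (fun ξ : EuclideanSpace ℝ (Fin d) =>
            (((2 * π * ‖ξ‖) ^ α : ℝ) : ℂ) * 𝓕 (⇑f) ξ) x) 2 volume := by
  let T : EuclideanSpace ℝ (Fin d) → ℂ := fun ξ ↦ (((2 * π * ‖ξ‖) ^ α : ℝ) : ℂ) * 𝓕 (⇑f) ξ
  set H : ℝ := (2 ^ (2 * α) * Real.Gamma (((d : ℝ) + 2 * α) / 4) ^ 2 /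
    Real.Gamma (((d : ℝ) - 2 * α) / 4) ^ 2) ^ (-(1 : ℝ) / 2) with hH
  have hT : T = fun ξ ↦ (((2 * π) ^ α : ℝ) : ℂ) * (((‖ξ‖ ^ α : ℝ) : ℂ) * 𝓕 f ξ) := by
    ext ξ
    simp only [T, SchwartzMap.fourier_coe]
    rw [mul_rpow (by positivity) (norm_nonneg _), Complex.ofReal_mul, mul_assoc]
  have hT1 : Integrable T := hT ▸ ((𝓕 f).integrable_rpow_norm_mul hα.le).const_mul _
  have hT2 : MemLp T 2 := hT ▸ ((𝓕 f).memLp_two_rpow_norm_mul hα.le).const_mul _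
  have hplancherel := eLpNorm_fourierInv_eq hT1 hT2
  have hherbst := f.eLpNorm_rpow_norm_mul_le hα (by simpa using hαd)
  rw [finrank_euclideanSpace_fin, ← hH, ← hplancherel] at hherbst
  have hH0 : 0 ≤ H := by positivity
  have hmeas : Measurable fun x : EuclideanSpace ℝ (Fin d) ↦ ((‖x‖ ^ (-α) : ℝ) : ℂ) * f x := by
    have := f.continuous.measurable
    fun_prop
  have hsplit : (fun x ↦ 𝓕⁻ T x + ((a * ‖x‖ ^ (-α) : ℝ) : ℂ) * f x) =
      𝓕⁻ T + (a : ℂ) • fun x ↦ ((‖x‖ ^ (-α) : ℝ) : ℂ) * f x := by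
    ext x
    simp [mul_assoc]
  change eLpNorm (fun x ↦ 𝓕⁻ T x + ((a * ‖x‖ ^ (-α) : ℝ) : ℂ) * f x) 2 volume ≤
    ENNReal.ofReal (1 + |a| * H) * eLpNorm (𝓕⁻ T) 2 volume
  rw [hsplit]
  calc _ ≤ eLpNorm (𝓕⁻ T) 2 volume +
        eLpNorm ((a : ℂ) • fun x ↦ ((‖x‖ ^ (-α) : ℝ) : ℂ) * f x) 2 volume :=
        eLpNorm_add_le (continuous_fourierInv hT1).aestronglyMeasurable
          (hmeas.const_smul _).aestronglyMeasurable (by norm_num)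
    _ ≤ eLpNorm (𝓕⁻ T) 2 volume +
        ENNReal.ofReal |a| * (ENNReal.ofReal H * eLpNorm (𝓕⁻ T) 2 volume) := by
        rw [eLpNorm_const_smul, ← ofReal_norm (a : ℂ), Complex.norm_real, norm_eq_abs]
        gcongr
    _ = _ := by
        rw [ENNReal.ofReal_add zero_le_one (by positivity), ENNReal.ofReal_one,
          ENNReal.ofReal_mul (abs_nonneg a), add_mul, one_mul, mul_assoc]
end

section
/- Let d ≥ 1 be an integer, let α > 0, s > 0 and δ ∈ ℝ satisfy δ > −α, sα < 2d and sα + 4δ < 2d. Then there exist constants 0 < c ≤ C < ∞, depending only on d, α, s, δ, such that for every real λ with 0 < λ ≤ 1/4: c·λ^{-δ} ≤ ∫₀^∞ t^{s/2} · min(1, t^{-d/α-1}) · max(1, λ^{-1} t^{1/α})^{δ} · max(1, t^{1/α})^{δ} dt ≤ C·λ^{-δ}. -/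
open MeasureTheory Real

/-- `max(1, λ⁻¹x)^δ ≤ λ^{-δ}(1 + x^δ)` for `x > 0` and `0 < λ ≤ 1`, whatever the sign of `δ`. -/
lemma max_one_inv_mul_rpow_le {lam x δ : ℝ} (hl : 0 < lam) (hl1 : lam ≤ 1) (hx : 0 < x) :
    (max 1 (lam⁻¹ * x)) ^ δ ≤ lam ^ (-δ) * (1 + x ^ δ) := by
  have hpos : 0 < lam⁻¹ * x := by positivity
  have hmul : (lam⁻¹ * x) ^ δ = lam ^ (-δ) * x ^ δ := by
    rw [mul_rpow (by positivity) hx.le, inv_rpow hl.le, rpow_neg hl.le]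
  have hlam : 0 < lam ^ (-δ) := by positivity
  have hxδ : 0 < x ^ δ := by positivity
  rcases le_total 0 δ with hδ | hδ
  · have hone : 1 ≤ lam ^ (-δ) :=
      one_le_rpow_of_pos_of_le_one_of_nonpos hl hl1 (by linarith)
    rcases max_choice 1 (lam⁻¹ * x) with h | h <;> rw [h]
    · rw [one_rpow]; nlinarith
    · rw [hmul]; nlinarith
  · calc (max 1 (lam⁻¹ * x)) ^ δ ≤ (lam⁻¹ * x) ^ δ :=
          rpow_le_rpow_of_nonpos hpos (le_max_right _ _) hδ
      _ ≤ _ := by rw [hmul]; nlinarith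

/-- The lower Lebesgue integral of a constant multiple of a nonnegative integrable function. -/
lemma setLIntegral_ofReal_const_mul {S : Set ℝ} (hS : MeasurableSet S) {f : ℝ → ℝ}
    (hf : IntegrableOn f S) (hf0 : ∀ t ∈ S, 0 ≤ f t) {K : ℝ} (hK : 0 ≤ K) :
    ∫⁻ t in S, ENNReal.ofReal (K * f t) = ENNReal.ofReal ((∫ t in S, f t) * K) := by
  rw [← ofReal_integral_eq_lintegral_ofReal (hf.const_mul K), integral_const_mul, mul_comm]
  filter_upwards [ae_restrict_mem hS] with t ht
  exact mul_nonneg hK (hf0 t ht)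

/-- Two-sided bound `c λ^{-δ} ≤ ∫₀^∞ t^{s/2} min(1, t^{-d/α-1}) max(1, λ⁻¹ t^{1/α})^δ
max(1, t^{1/α})^δ dt ≤ C λ^{-δ}`, uniform in `0 < λ ≤ 1/4`. -/
theorem riesz_integral_case2 (d : ℕ) (hd : 1 ≤ d) (α s δ : ℝ) (hα : 0 < α) (hs : 0 < s)
    (hδ : -α < δ) (h1 : s * α < 2 * d) (h2 : s * α + 4 * δ < 2 * d) :
    ∃ c C : ℝ, 0 < c ∧ c ≤ C ∧ ∀ lam : ℝ, 0 < lam → lam ≤ 1 / 4 →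
      ENNReal.ofReal (c * lam ^ (-δ)) ≤
        (∫⁻ t in Set.Ioi (0 : ℝ), ENNReal.ofReal
          (t ^ (s / 2) * min 1 (t ^ (-((d : ℝ) / α) - 1)) *
            (max 1 (lam⁻¹ * t ^ (1 / α))) ^ δ * (max 1 (t ^ (1 / α))) ^ δ)) ∧
      (∫⁻ t in Set.Ioi (0 : ℝ), ENNReal.ofReal
          (t ^ (s / 2) * min 1 (t ^ (-((d : ℝ) / α) - 1)) *
            (max 1 (lam⁻¹ * t ^ (1 / α))) ^ δ * (max 1 (t ^ (1 / α))) ^ δ)) ≤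
        ENNReal.ofReal (C * lam ^ (-δ)) := by
  have hd0 : 0 < (d : ℝ) := by exact_mod_cast hd
  set p : ℝ := s / 2 + (-((d : ℝ) / α) - 1) + 1 / α * δ + 1 / α * δ with hp
  set q : ℝ := s / 2 + 1 / α * δ with hq
  have hp1 : p < -1 := by
    have : (p + 1) * α = s * α / 2 - d + 2 * δ := by rw [hp]; field_simp; ring
    nlinarith
  have hq1 : -1 < q := by
    have : (q + 1) * α = s * α / 2 + α + δ := by rw [hq]; field_simp; ring
    nlinarith [mul_pos hs hα]
  have hIntP : IntegrableOn (fun t : ℝ => t ^ p) (Set.Ioi 1) :=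
    integrableOn_Ioi_rpow_of_lt hp1 one_pos
  have hIntQ : IntegrableOn (fun t : ℝ => t ^ (s / 2) + t ^ q) (Set.Ioc 0 1) :=
    ((intervalIntegral.intervalIntegrable_rpow' (by linarith)).1).add
      (intervalIntegral.intervalIntegrable_rpow' hq1).1
  have hP : 0 < ∫ t in Set.Ioi (1 : ℝ), t ^ p := by
    rw [integral_Ioi_rpow_of_lt hp1 one_pos, one_rpow]
    exact div_pos_of_neg_of_neg (by norm_num) (by linarith)
  have hP0 : ∀ t ∈ Set.Ioi (1 : ℝ), 0 ≤ t ^ p := fun t ht =>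
    rpow_nonneg (zero_le_one.trans (le_of_lt ht)) _
  have hQ0 : ∀ t ∈ Set.Ioc (0 : ℝ) 1, 0 ≤ t ^ (s / 2) + t ^ q := fun t ht =>
    add_nonneg (rpow_nonneg ht.1.le _) (rpow_nonneg ht.1.le _)
  have hQ : 0 ≤ ∫ t in Set.Ioc (0 : ℝ) 1, (t ^ (s / 2) + t ^ q) :=
    setIntegral_nonneg measurableSet_Ioc hQ0
  refine ⟨∫ t in Set.Ioi (1 : ℝ), t ^ p,
    (∫ t in Set.Ioc (0 : ℝ) 1, (t ^ (s / 2) + t ^ q)) + ∫ t in Set.Ioi (1 : ℝ), t ^ p,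
    hP, le_add_of_nonneg_left hQ, fun lam hl hl4 => ?_⟩
  have hK : 0 ≤ lam ^ (-δ) := by positivity
  rw [← Set.Ioc_union_Ioi_eq_Ioi zero_le_one,
    lintegral_union measurableSet_Ioi (Set.Ioc_disjoint_Ioi le_rfl)]
  have hLarge : ∫⁻ t in Set.Ioi (1 : ℝ), ENNReal.ofReal
      (t ^ (s / 2) * min 1 (t ^ (-((d : ℝ) / α) - 1)) *
        (max 1 (lam⁻¹ * t ^ (1 / α))) ^ δ * (max 1 (t ^ (1 / α))) ^ δ) =
      ENNReal.ofReal ((∫ t in Set.Ioi (1 : ℝ), t ^ p) * lam ^ (-δ)) := by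
    rw [← setLIntegral_ofReal_const_mul measurableSet_Ioi hIntP hP0 hK]
    refine setLIntegral_congr_fun measurableSet_Ioi fun t (ht : 1 < t) => ?_
    have ht0 : 0 < t := one_pos.trans ht
    have htα : 1 ≤ t ^ (1 / α) := one_le_rpow ht.le (by positivity)
    have hmin : t ^ (-((d : ℝ) / α) - 1) ≤ 1 :=
      rpow_le_one_of_one_le_of_nonpos ht.le (by have := div_pos hd0 hα; linarith)
    have hinv : 1 ≤ lam⁻¹ := (one_le_inv₀ hl).2 (by linarith)
    rw [min_eq_right hmin, max_eq_right htα, max_eq_right (one_le_mul_of_one_le_of_one_le hinv htα),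
      mul_rpow (by positivity) (by positivity), inv_rpow hl.le, ← rpow_neg hl.le,
      ← rpow_mul ht0.le, hp, rpow_add ht0, rpow_add ht0, rpow_add ht0]
    congr 1
    ring
  have hSmall : ∫⁻ t in Set.Ioc (0 : ℝ) 1, ENNReal.ofReal
      (t ^ (s / 2) * min 1 (t ^ (-((d : ℝ) / α) - 1)) *
        (max 1 (lam⁻¹ * t ^ (1 / α))) ^ δ * (max 1 (t ^ (1 / α))) ^ δ) ≤
      ENNReal.ofReal ((∫ t in Set.Ioc (0 : ℝ) 1, (t ^ (s / 2) + t ^ q)) * lam ^ (-δ)) := by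
    rw [← setLIntegral_ofReal_const_mul measurableSet_Ioc hIntQ hQ0 hK]
    refine setLIntegral_mono' measurableSet_Ioc fun t ht => ENNReal.ofReal_le_ofReal ?_
    have ht0 : 0 < t := ht.1
    have htα : t ^ (1 / α) ≤ 1 := rpow_le_one ht0.le ht.2 (by positivity)
    rw [max_eq_left htα, one_rpow, mul_one]
    calc t ^ (s / 2) * min 1 (t ^ (-((d : ℝ) / α) - 1)) * (max 1 (lam⁻¹ * t ^ (1 / α))) ^ δ
        ≤ t ^ (s / 2) * 1 * (lam ^ (-δ) * (1 + (t ^ (1 / α)) ^ δ)) := by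
          gcongr
          · exact min_le_left _ _
          · exact max_one_inv_mul_rpow_le hl (by linarith) (by positivity)
      _ = lam ^ (-δ) * (t ^ (s / 2) + t ^ q) := by
          rw [← rpow_mul ht0.le, hq, rpow_add ht0]; ring
  rw [hLarge]
  refine ⟨le_add_self, ?_⟩
  rw [add_mul, ENNReal.ofReal_add (mul_nonneg hQ hK) (mul_nonneg hP.le hK)]
  gcongr
end

section
/- Let d ≥ 1 be an integer and let σ > 0 and δ ≥ 0 satisfy 2(σ + δ) < d. Then there exists a constant C < ∞ such that for every measurable function g : ℝ^d → [0,∞], ∫_{ℝ^d} ( ∫_{ℝ^d} |x|^{-σ} |x−y|^{σ−d} · min(1, |x|/|x−y|, |y|/|x−y|)^{-δ} · g(y) dy )² dx ≤ C · ∫_{ℝ^d} g(y)² dy, the integrals being taken in the extended nonnegative reals. -/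
open MeasureTheory Real

open scoped ENNReal

/-- **Schur test** with weights `v` and `w`, in the extended nonnegative reals. -/
theorem lintegral_sq_lintegral_mul_le_of_schur {α β : Type*} [MeasurableSpace α]
    [MeasurableSpace β] {μ : Measure α} {ν : Measure β} [SFinite μ] [SFinite ν]
    {K : α → β → ℝ≥0∞} (hK : Measurable (Function.uncurry K))
    {v : α → ℝ≥0∞} {w : β → ℝ≥0∞} (hw : Measurable w) (hv : Measurable v)
    (hw0 : ∀ᵐ y ∂ν, w y ≠ 0) (hwtop : ∀ᵐ y ∂ν, w y ≠ ∞) {A B : ℝ≥0∞}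
    (hrow : ∀ᵐ x ∂μ, ∫⁻ y, K x y * w y ∂ν ≤ A * v x)
    (hcol : ∀ᵐ y ∂ν, ∫⁻ x, K x y * v x ∂μ ≤ B * w y)
    {g : β → ℝ≥0∞} (hg : Measurable g) :
    ∫⁻ x, (∫⁻ y, K x y * g y ∂ν) ^ 2 ∂μ ≤ A * B * ∫⁻ y, g y ^ 2 ∂ν := by
  have hKx (x : α) : Measurable (K x) := hK.comp measurable_prodMk_left
  have hKy (y : β) : Measurable fun x => K x y := hK.comp measurable_prodMk_right
  have cauchy (x : α) : (∫⁻ y, K x y * g y ∂ν) ^ 2 ≤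
      (∫⁻ y, K x y * w y ∂ν) * ∫⁻ y, K x y * (g y ^ 2 / w y) ∂ν := by
    have holder := ENNReal.lintegral_mul_le_Lp_mul_Lq ν
      (Real.HolderConjugate.two_two)
      (f := fun y => (K x y * w y) ^ (1 / 2 : ℝ))
      (g := fun y => (K x y * (g y ^ 2 / w y)) ^ (1 / 2 : ℝ))
      (by have := hKx x; fun_prop) (by have := hKx x; fun_prop)
    have sq_rpow_half (c : ℝ≥0∞) : (c ^ (1 / 2 : ℝ)) ^ (2 : ℝ) = c := by
      rw [← ENNReal.rpow_mul]; norm_num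
    simp only [Pi.mul_apply, sq_rpow_half] at holder
    have hle : ∫⁻ y, K x y * g y ∂ν ≤ ∫⁻ y, (K x y * w y) ^ (1 / 2 : ℝ) *
        (K x y * (g y ^ 2 / w y)) ^ (1 / 2 : ℝ) ∂ν := by
      refine lintegral_mono_ae ?_
      filter_upwards [hw0, hwtop] with y h0 htop
      rw [← ENNReal.mul_rpow_of_nonneg _ _ (by norm_num : (0 : ℝ) ≤ 1 / 2)]
      have : K x y * w y * (K x y * (g y ^ 2 / w y)) = (K x y * g y) ^ (2 : ℝ) := by
        rw [mul_mul_mul_comm, ENNReal.mul_div_cancel h0 htop, ENNReal.rpow_two]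
        ring
      rw [this, ← ENNReal.rpow_mul]
      norm_num
    calc (∫⁻ y, K x y * g y ∂ν) ^ 2
        ≤ ((∫⁻ y, K x y * w y ∂ν) ^ (1 / 2 : ℝ) *
            (∫⁻ y, K x y * (g y ^ 2 / w y) ∂ν) ^ (1 / 2 : ℝ)) ^ 2 := by
          gcongr; exact hle.trans holder
      _ = _ := by
          rw [mul_pow, ← ENNReal.rpow_two, ← ENNReal.rpow_two, sq_rpow_half, sq_rpow_half]
  calc ∫⁻ x, (∫⁻ y, K x y * g y ∂ν) ^ 2 ∂μ
      ≤ ∫⁻ x, ∫⁻ y, A * (v x * (K x y * (g y ^ 2 / w y))) ∂ν ∂μ := by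
        refine lintegral_mono_ae ?_
        filter_upwards [hrow] with x hx
        rw [lintegral_const_mul _ (by have := hKx x; fun_prop),
          lintegral_const_mul _ (by have := hKx x; fun_prop), ← mul_assoc]
        exact (cauchy x).trans (by gcongr)
    _ = ∫⁻ y, ∫⁻ x, A * (v x * (K x y * (g y ^ 2 / w y))) ∂μ ∂ν := by
        refine lintegral_lintegral_swap (Measurable.aemeasurable ?_)
        have : Measurable fun z : α × β => K z.1 z.2 := hK
        simp only [Function.uncurry_def]
        fun_prop
    _ ≤ ∫⁻ y, A * B * g y ^ 2 ∂ν := by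
        refine lintegral_mono_ae ?_
        filter_upwards [hcol, hw0, hwtop] with y hy h0 htop
        have : ∀ x, A * (v x * (K x y * (g y ^ 2 / w y))) =
            A * (g y ^ 2 / w y) * (K x y * v x) := fun x => by ring
        simp_rw [this]
        rw [lintegral_const_mul _ (by have := hKy y; fun_prop)]
        calc A * (g y ^ 2 / w y) * ∫⁻ x, K x y * v x ∂μ
            ≤ A * (g y ^ 2 / w y) * (B * w y) := by gcongr
          _ = A * B * (w y * (g y ^ 2 / w y)) := by ring
          _ = A * B * g y ^ 2 := by rw [ENNReal.mul_div_cancel h0 htop]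
    _ = A * B * ∫⁻ y, g y ^ 2 ∂ν := lintegral_const_mul _ (hg.pow_const 2)

section NormPowers

variable {E : Type*} [NormedAddCommGroup E] [NormedSpace ℝ E] [FiniteDimensional ℝ E]
  [MeasurableSpace E] [BorelSpace E] (μ : Measure E) [μ.IsAddHaarMeasure]

theorem integrable_norm_rpow_mul_max_rpow [Nontrivial E] {p q : ℝ}
    (hp : p < Module.finrank ℝ E) (hpq : Module.finrank ℝ E < p + q) :
    Integrable (fun y : E => ‖y‖ ^ (-p) * max ‖y‖ 1 ^ (-q)) μ := by
  have hd : 1 ≤ Module.finrank ℝ E := Module.finrank_pos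
  have key := integrable_fun_norm_addHaar (E := E) μ
    (f := fun r : ℝ => r ^ (-p) * max r 1 ^ (-q))
  refine key.2 ?_
  have hpow {r : ℝ} (hr : 0 < r) (a : ℝ) :
      r ^ (Module.finrank ℝ E - 1) * r ^ a = r ^ ((Module.finrank ℝ E : ℝ) - 1 + a) := by
    rw [Real.rpow_add hr, ← Real.rpow_natCast, Nat.cast_sub hd, Nat.cast_one]
  rw [← Set.Ioc_union_Ioi_eq_Ioi zero_le_one, integrableOn_union]
  constructor
  · rw [integrableOn_Ioc_iff_integrableOn_Ioo]
    refine ((intervalIntegral.integrableOn_Ioo_rpow_iff one_pos).2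
      (by linarith : -1 < (Module.finrank ℝ E : ℝ) - 1 + -p)).congr_fun ?_ measurableSet_Ioo
    intro r hr
    simp only [smul_eq_mul]
    rw [max_eq_right hr.2.le, Real.one_rpow, mul_one, hpow hr.1]
  · refine (integrableOn_Ioi_rpow_of_lt
      (by linarith : (Module.finrank ℝ E : ℝ) - 1 + (-p + -q) < -1) one_pos).congr_fun ?_
      measurableSet_Ioi
    intro r hr
    have h0 : (0 : ℝ) < r := one_pos.trans hr
    simp only [smul_eq_mul]
    rw [max_eq_left (le_of_lt hr), ← Real.rpow_add h0, hpow h0]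

theorem lintegral_norm_rpow_mul_max_rpow [Nontrivial E] {p q ρ : ℝ}
    (hp : p < Module.finrank ℝ E) (hpq : Module.finrank ℝ E < p + q) (hρ : 0 < ρ) :
    ∫⁻ y : E, ENNReal.ofReal (‖y‖ ^ (-p) * max ‖y‖ ρ ^ (-q)) ∂μ =
      ENNReal.ofReal (ρ ^ (Module.finrank ℝ E - p - q) *
        ∫ y : E, ‖y‖ ^ (-p) * max ‖y‖ 1 ^ (-q) ∂μ) := by
  have hscale (y : E) : ‖y‖ ^ (-p) * max ‖y‖ ρ ^ (-q) =
      ρ ^ (-p - q) * (‖ρ⁻¹ • y‖ ^ (-p) * max ‖ρ⁻¹ • y‖ 1 ^ (-q)) := by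
    have h1 : ‖y‖ = ρ * ‖ρ⁻¹ • y‖ := by
      rw [norm_smul, norm_inv, Real.norm_of_nonneg hρ.le, mul_inv_cancel_left₀ hρ.ne']
    have h2 : max ‖y‖ ρ = ρ * max ‖ρ⁻¹ • y‖ 1 := by
      rw [mul_max_of_nonneg _ _ hρ.le, mul_one, ← h1]
    rw [h2, h1, Real.mul_rpow hρ.le (norm_nonneg _), Real.mul_rpow hρ.le (by positivity),
      sub_eq_add_neg (-p), Real.rpow_add hρ]
    ring
  have hint := integrable_norm_rpow_mul_max_rpow μ hp hpq
  rw [← ofReal_integral_eq_lintegral_ofReal]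
  · simp_rw [hscale]
    rw [integral_const_mul, Measure.integral_comp_inv_smul_of_nonneg μ
      (fun y : E => ‖y‖ ^ (-p) * max ‖y‖ 1 ^ (-q)) hρ.le, smul_eq_mul, ← mul_assoc,
      ← Real.rpow_natCast, ← Real.rpow_add hρ]
    congr 3
    ring
  · simp_rw [hscale]
    exact (hint.comp_smul (inv_ne_zero hρ.ne')).const_mul _
  · exact Filter.Eventually.of_forall fun y => by positivity

/-- The convolution of two homogeneous powers `‖y‖ ^ (-p)` and `‖y‖ ^ (-q)`, each locally
integrable, with integrable product at infinity, is bounded by `‖x‖ ^ (dim - p - q)`. -/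
theorem exists_lintegral_norm_rpow_mul_norm_sub_rpow_le [Nontrivial E] {p q : ℝ}
    (hp0 : 0 ≤ p) (hq0 : 0 ≤ q) (hp : p < Module.finrank ℝ E) (hq : q < Module.finrank ℝ E)
    (hpq : Module.finrank ℝ E < p + q) :
    ∃ C : ℝ, ∀ x : E, x ≠ 0 →
      ∫⁻ y, ENNReal.ofReal (‖y‖ ^ (-p) * ‖x - y‖ ^ (-q)) ∂μ ≤
        ENNReal.ofReal C * ENNReal.ofReal (‖x‖ ^ (Module.finrank ℝ E - p - q)) := by
  set J₁ := ∫ y : E, ‖y‖ ^ (-p) * max ‖y‖ 1 ^ (-q) ∂μ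
  set J₂ := ∫ y : E, ‖y‖ ^ (-q) * max ‖y‖ 1 ^ (-p) ∂μ
  have hJ₁ : 0 ≤ J₁ := integral_nonneg fun y => by positivity
  have hJ₂ : 0 ≤ J₂ := integral_nonneg fun y => by positivity
  refine ⟨(1 / 2) ^ (Module.finrank ℝ E - p - q) * (J₁ + J₂), fun x hx => ?_⟩
  have hx0 : 0 < ‖x‖ := norm_pos_iff.2 hx
  set ρ := 1 / 2 * ‖x‖ with hρ_def
  have hρ : 0 < ρ := by positivity
  have pointwise (y : E) : ‖y‖ ^ (-p) * ‖x - y‖ ^ (-q) ≤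
      ‖y‖ ^ (-p) * max ‖y‖ ρ ^ (-q) + ‖x - y‖ ^ (-q) * max ‖x - y‖ ρ ^ (-p) := by
    have htri : ‖x‖ ≤ ‖x - y‖ + ‖y‖ := by simpa using norm_add_le (x - y) y
    rcases le_total ‖y‖ ‖x - y‖ with hle | hle
    · have hmax : max ‖y‖ ρ ≤ ‖x - y‖ := max_le hle (by linarith)
      have := Real.rpow_le_rpow_of_nonpos (by positivity) hmax (neg_nonpos.2 hq0)
      exact (mul_le_mul_of_nonneg_left this (by positivity)).trans
        (le_add_of_nonneg_right (by positivity))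
    · have hmax : max ‖x - y‖ ρ ≤ ‖y‖ := max_le hle (by linarith)
      have := Real.rpow_le_rpow_of_nonpos (by positivity) hmax (neg_nonpos.2 hp0)
      rw [mul_comm]
      exact (mul_le_mul_of_nonneg_left this (by positivity)).trans
        (le_add_of_nonneg_left (by positivity))
  calc ∫⁻ y, ENNReal.ofReal (‖y‖ ^ (-p) * ‖x - y‖ ^ (-q)) ∂μ
      ≤ ∫⁻ y, (ENNReal.ofReal (‖y‖ ^ (-p) * max ‖y‖ ρ ^ (-q)) +
          ENNReal.ofReal (‖x - y‖ ^ (-q) * max ‖x - y‖ ρ ^ (-p))) ∂μ := by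
        refine lintegral_mono fun y => ?_
        rw [← ENNReal.ofReal_add (by positivity) (by positivity)]
        exact ENNReal.ofReal_le_ofReal (pointwise y)
    _ = ENNReal.ofReal (ρ ^ (Module.finrank ℝ E - p - q) * J₁) +
          ENNReal.ofReal (ρ ^ (Module.finrank ℝ E - q - p) * J₂) := by
        rw [lintegral_add_left (by fun_prop), lintegral_norm_rpow_mul_max_rpow μ hp hpq hρ,
          lintegral_sub_left_eq_self (μ := μ)
            (fun z => ENNReal.ofReal (‖z‖ ^ (-q) * max ‖z‖ ρ ^ (-p))) x,
          lintegral_norm_rpow_mul_max_rpow μ hq (by linarith) hρ]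
    _ = _ := by
        rw [← ENNReal.ofReal_add (by positivity) (by positivity),
          ← ENNReal.ofReal_mul (by positivity), sub_right_comm _ q p, hρ_def,
          Real.mul_rpow (by positivity) hx0.le]
        congr 1
        ring

end NormPowers

/-- The Stein–Weiss kernel `‖x‖ ^ (-a) * ‖y‖ ^ (-b) * ‖x - y‖ ^ (a + b - d)`. -/
noncomputable def steinWeissKernel (d : ℕ) (a b : ℝ) (x y : EuclideanSpace ℝ (Fin d)) : ℝ≥0∞ :=
  ENNReal.ofReal (‖x‖ ^ (-a) * ‖y‖ ^ (-b) * ‖x - y‖ ^ (a + b - (d : ℝ)))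

theorem steinWeissKernel_comm (d : ℕ) (a b : ℝ) (x y : EuclideanSpace ℝ (Fin d)) :
    steinWeissKernel d a b x y = steinWeissKernel d b a y x := by
  rw [steinWeissKernel, steinWeissKernel, norm_sub_rev, add_comm a b, mul_comm (‖x‖ ^ (-a))]

theorem measurable_uncurry_steinWeissKernel (d : ℕ) (a b : ℝ) :
    Measurable (Function.uncurry (steinWeissKernel d a b)) := by
  simp only [Function.uncurry_def, steinWeissKernel]
  fun_prop

theorem exists_lintegral_steinWeissKernel_le {d : ℕ} (hd : 1 ≤ d) {a b : ℝ} (ha : 0 ≤ a)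
    (hb : 0 ≤ b) (hab : 0 < a + b) (h : 2 * (a + b) < d) :
    ∃ C : ℝ, ∀ x : EuclideanSpace ℝ (Fin d), x ≠ 0 →
      ∫⁻ y, steinWeissKernel d a b x y * ENNReal.ofReal (‖y‖ ^ (-(d / 2 : ℝ))) ≤
        ENNReal.ofReal C * ENNReal.ofReal (‖x‖ ^ (-(d / 2 : ℝ))) := by
  have : NeZero d := ⟨by omega⟩
  have hdim : (Module.finrank ℝ (EuclideanSpace ℝ (Fin d)) : ℝ) = d := by simp
  obtain ⟨C, hC⟩ := exists_lintegral_norm_rpow_mul_norm_sub_rpow_le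
    (volume : Measure (EuclideanSpace ℝ (Fin d))) (p := b + d / 2) (q := d - a - b)
    (by positivity) (by linarith) (by rw [hdim]; linarith) (by rw [hdim]; linarith)
    (by rw [hdim]; linarith)
  refine ⟨C, fun x hx => ?_⟩
  have hx0 : 0 < ‖x‖ := norm_pos_iff.2 hx
  have hsplit (y : EuclideanSpace ℝ (Fin d)) :
      steinWeissKernel d a b x y * ENNReal.ofReal (‖y‖ ^ (-(d / 2 : ℝ))) =
        ENNReal.ofReal (‖x‖ ^ (-a)) *
          ENNReal.ofReal (‖y‖ ^ (-(b + d / 2 : ℝ)) * ‖x - y‖ ^ (-(d - a - b : ℝ))) := by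
    rw [steinWeissKernel, ← ENNReal.ofReal_mul (by positivity),
      ← ENNReal.ofReal_mul (by positivity), neg_add b,
      Real.rpow_add' (norm_nonneg y) (by have : (0 : ℝ) < d := by positivity
                                         linarith),
      show -(d - a - b : ℝ) = a + b - d by ring]
    congr 1
    ring
  simp_rw [hsplit]
  rw [lintegral_const_mul _ (by fun_prop)]
  calc _ ≤ ENNReal.ofReal (‖x‖ ^ (-a)) * (ENNReal.ofReal C *
        ENNReal.ofReal (‖x‖ ^ ((d : ℝ) - (b + d / 2) - (d - a - b)))) := by
        gcongr
        simpa only [hdim] using hC x hx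
    _ = _ := by
        rw [mul_left_comm, ← ENNReal.ofReal_mul (by positivity), ← Real.rpow_add hx0]
        congr 3
        ring

/-- **Stein–Weiss inequality** in `L²`, for finitely many kernels at once. -/
theorem exists_lintegral_sq_sum_steinWeissKernel_le {ι : Type*} (s : Finset ι) {d : ℕ}
    (hd : 1 ≤ d) (a b : ι → ℝ) (ha : ∀ i, 0 ≤ a i) (hb : ∀ i, 0 ≤ b i)
    (hab : ∀ i, 0 < a i + b i) (h : ∀ i, 2 * (a i + b i) < d) :
    ∃ C : ℝ, ∀ g : EuclideanSpace ℝ (Fin d) → ℝ≥0∞, Measurable g →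
      ∫⁻ x, (∫⁻ y, (∑ i ∈ s, steinWeissKernel d (a i) (b i) x y) * g y) ^ 2 ≤
        ENNReal.ofReal C * ∫⁻ y, g y ^ 2 := by
  have : NeZero d := ⟨by omega⟩
  choose A hA using fun i =>
    exists_lintegral_steinWeissKernel_le hd (ha i) (hb i) (hab i) (h i)
  choose B hB using fun i => exists_lintegral_steinWeissKernel_le hd (hb i) (ha i)
    (by rw [add_comm]; exact hab i) (by rw [add_comm]; exact h i)
  have hmeas (i : ι) : Measurable fun z : EuclideanSpace ℝ (Fin d) × EuclideanSpace ℝ (Fin d) =>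
      steinWeissKernel d (a i) (b i) z.1 z.2 := measurable_uncurry_steinWeissKernel d (a i) (b i)
  have hne : ∀ᵐ x : EuclideanSpace ℝ (Fin d), x ≠ 0 := Measure.ae_ne volume 0
  have htop (D : ι → ℝ) : ∑ i ∈ s, ENNReal.ofReal (D i) ≠ ∞ := by simp
  refine ⟨((∑ i ∈ s, ENNReal.ofReal (A i)) * ∑ i ∈ s, ENNReal.ofReal (B i)).toReal,
    fun g hg => ?_⟩
  rw [ENNReal.ofReal_toReal (ENNReal.mul_ne_top (htop A) (htop B))]
  refine lintegral_sq_lintegral_mul_le_of_schur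
    (v := fun x => ENNReal.ofReal (‖x‖ ^ (-(d / 2 : ℝ))))
    (w := fun x => ENNReal.ofReal (‖x‖ ^ (-(d / 2 : ℝ))))
    ?_ (by fun_prop) (by fun_prop) ?_ (by simp) ?_ ?_ hg
  · exact Finset.measurable_fun_sum s fun i _ => hmeas i
  · filter_upwards [hne] with y hy
    have : 0 < ‖y‖ := norm_pos_iff.2 hy
    rw [ne_eq, ENNReal.ofReal_eq_zero, not_le]
    positivity
  · filter_upwards [hne] with x hx
    simp_rw [Finset.sum_mul]
    rw [lintegral_finsetSum _ fun i _ => by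
      have := (hmeas i).comp (measurable_prodMk_left (x := x))
      simp only [Function.comp_def] at this
      fun_prop]
    exact Finset.sum_le_sum fun i _ => hA i x hx
  · filter_upwards [hne] with y hy
    simp_rw [Finset.sum_mul]
    rw [lintegral_finsetSum _ fun i _ => by
      have := (hmeas i).comp (measurable_prodMk_right (y := y))
      simp only [Function.comp_def] at this
      fun_prop]
    refine Finset.sum_le_sum fun i _ => ?_
    simp_rw [steinWeissKernel_comm d (a i) (b i)]
    exact hB i y hy

theorem min_one_div_rpow_neg_le {u v r δ : ℝ} (hu : 0 < u) (hv : 0 < v) (hr : 0 < r) :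
    min (min 1 (u / r)) (v / r) ^ (-δ) ≤
      1 + u ^ (-δ) * r ^ δ + v ^ (-δ) * r ^ δ := by
  have hdiv {c : ℝ} (hc : 0 < c) : (c / r) ^ (-δ) = c ^ (-δ) * r ^ δ := by
    rw [Real.div_rpow hc.le hr.le, Real.rpow_neg hr.le, div_inv_eq_mul]
  have hu' : 0 ≤ u ^ (-δ) * r ^ δ := by positivity
  have hv' : 0 ≤ v ^ (-δ) * r ^ δ := by positivity
  rcases min_choice (min 1 (u / r)) (v / r) with h | h <;> rw [h]
  · rcases min_choice 1 (u / r) with h | h <;> rw [h]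
    · rw [Real.one_rpow]; linarith
    · rw [hdiv hu]; linarith
  · rw [hdiv hv]; linarith

theorem riesz_kernel_le_sum_steinWeissKernel {d : ℕ} {σ δ : ℝ} (hσ : 0 < σ) (hδ : 0 ≤ δ)
    (h : 2 * (σ + δ) < d) {x y : EuclideanSpace ℝ (Fin d)} (hx : x ≠ 0) (hy : y ≠ 0) :
    ENNReal.ofReal (‖x‖ ^ (-σ) * ‖x - y‖ ^ (σ - (d : ℝ)) *
        (min (min 1 (‖x‖ / ‖x - y‖)) (‖y‖ / ‖x - y‖)) ^ (-δ)) ≤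
      ∑ i : Fin 3, steinWeissKernel d (![σ, σ + δ, σ] i) (![0, 0, δ] i) x y := by
  rcases eq_or_ne x y with rfl | hxy
  · rw [sub_self, norm_zero, Real.zero_rpow (by linarith)]
    simp
  have hx0 : 0 < ‖x‖ := norm_pos_iff.2 hx
  have hy0 : 0 < ‖y‖ := norm_pos_iff.2 hy
  have hr : 0 < ‖x - y‖ := norm_pos_iff.2 (sub_ne_zero.2 hxy)
  simp only [Fin.sum_univ_three, steinWeissKernel, Matrix.cons_val]
  rw [← ENNReal.ofReal_add (by positivity) (by positivity),
    ← ENNReal.ofReal_add (by positivity) (by positivity)]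
  refine ENNReal.ofReal_le_ofReal ((mul_le_mul_of_nonneg_left
    (min_one_div_rpow_neg_le hx0 hy0 hr) (by positivity)).trans_eq ?_)
  rw [add_zero, add_zero, neg_zero, Real.rpow_zero, neg_add, Real.rpow_add hx0,
    show σ + δ - (d : ℝ) = (σ - d) + δ by ring, Real.rpow_add hr]
  ring

/-- Schur test: `L²`-boundedness of the integral operator with kernel
`|x|^{-σ} |x-y|^{σ-d} min(1, |x|/|x-y|, |y|/|x-y|)^{-δ}` when `2(σ+δ) < d`. -/
theorem schur_test_riesz_kernel (d : ℕ) (hd : 1 ≤ d) (σ δ : ℝ) (hσ : 0 < σ) (hδ : 0 ≤ δ)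
    (h : 2 * (σ + δ) < d) :
    ∃ C : ℝ, ∀ g : EuclideanSpace ℝ (Fin d) → ENNReal, Measurable g →
      (∫⁻ x : EuclideanSpace ℝ (Fin d),
        (∫⁻ y : EuclideanSpace ℝ (Fin d),
          ENNReal.ofReal (‖x‖ ^ (-σ) * ‖x - y‖ ^ (σ - (d : ℝ)) *
            (min (min 1 (‖x‖ / ‖x - y‖)) (‖y‖ / ‖x - y‖)) ^ (-δ)) * g y) ^ 2)
        ≤ ENNReal.ofReal C * ∫⁻ y : EuclideanSpace ℝ (Fin d), (g y) ^ 2 := by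
  have : NeZero d := ⟨by omega⟩
  have hne : ∀ᵐ x : EuclideanSpace ℝ (Fin d), x ≠ 0 := Measure.ae_ne volume 0
  obtain ⟨C, hC⟩ := exists_lintegral_sq_sum_steinWeissKernel_le Finset.univ hd
    ![σ, σ + δ, σ] ![0, 0, δ]
    (fun i => by fin_cases i <;> simp <;> linarith)
    (fun i => by fin_cases i <;> simp [hδ])
    (fun i => by fin_cases i <;> simp <;> linarith)
    (fun i => by fin_cases i <;> simp <;> linarith)
  refine ⟨C, fun g hg => (lintegral_mono_ae ?_).trans (hC g hg)⟩
  filter_upwards [hne] with x hx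
  gcongr ?_ ^ 2
  refine lintegral_mono_ae ?_
  filter_upwards [hne] with y hy
  gcongr
  exact riesz_kernel_le_sum_steinWeissKernel hσ hδ h hx hy
end
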